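/- Let b be a rational function in the closed unit ball of H∞ with ‖b‖∞ = 1 that is not a finite Blaschke product. Let φ ∈ H(b) ∩ ball(H∞) with φ(ξ_j) ∈ Z_T(a) for 1 ≤ j ≤ p and φ(ξ_j) ∈ D for p+1 ≤ j ≤ n, and let u = (a₁ ∘ φ) · ∏_{j=p+1}^n (φ − φ(ξ_j))^{m_j} / a₁. Assume u ∈ H² and that for some δ > 0 the essential supremum of |u| over A_δ = {ζ ∈ T : |φ(ζ)| ≥ 1 − δ} is finite. Then the composition operator C_φ is bounded on H(b). -/

import Mathlib

open Complex MeasureTheory Set Filter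

noncomputable section

attribute [local instance] Classical.propDecidable

/-- The open unit disk in `ℂ`. -/
def unitDisk : Set ℂ := Metric.ball 0 1

/-- The unit circle in `ℂ`. -/
def unitCircle : Set ℂ := Metric.sphere 0 1

/-- Membership in `H^∞`: analytic and bounded on the unit disk. -/
def MemHinf (f : ℂ → ℂ) : Prop :=
  DifferentiableOn ℂ f unitDisk ∧ ∃ C : ℝ, ∀ z ∈ unitDisk, ‖f z‖ ≤ C

/-- Membership in the closed unit ball of `H^∞`. -/
def MemBallHinf (f : ℂ → ℂ) : Prop :=
  DifferentiableOn ℂ f unitDisk ∧ ∀ z ∈ unitDisk, ‖f z‖ ≤ 1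

/-- `f` agrees on the closed unit disk with a rational function without poles there. -/
def IsRationalOnDisk (f : ℂ → ℂ) : Prop :=
  ∃ P Q : Polynomial ℂ, ∀ z ∈ Metric.closedBall (0:ℂ) 1,
    Q.eval z ≠ 0 ∧ f z = P.eval z / Q.eval z

/-- `f` is a finite Blaschke product (multiplicities are encoded by repetition). -/
def IsFiniteBlaschke (f : ℂ → ℂ) : Prop :=
  ∃ (γ : ℂ) (k : ℕ) (lam : Fin k → ℂ), ‖γ‖ = 1 ∧ (∀ i, lam i ∈ unitDisk) ∧
    ∀ z ∈ unitDisk, f z = γ * ∏ i, (z - lam i) / (1 - (starRingEnd ℂ) (lam i) * z)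

/-- The `k`-th Taylor coefficient of `f` at the origin. -/
def taylorCoeff (f : ℂ → ℂ) (k : ℕ) : ℂ := iteratedDeriv k f 0 / k.factorial

/-- Membership in the Hardy space `H²` (square-summable Taylor coefficients). -/
def MemH2 (f : ℂ → ℂ) : Prop :=
  DifferentiableOn ℂ f unitDisk ∧ Summable fun k => ‖taylorCoeff f k‖ ^ 2

/-- The squared `H²` norm. -/
def h2NormSq (f : ℂ → ℂ) : ℝ := ∑' k, ‖taylorCoeff f k‖ ^ 2

/-- The `H²` inner product. -/
def h2Inner (f g : ℂ → ℂ) : ℂ :=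
  ∑' k, (starRingEnd ℂ) (taylorCoeff f k) * taylorCoeff g k

/-- The polynomial `a₁(z) = ∏ⱼ (z − ξⱼ)^{mⱼ}`. -/
def a1fun {n : ℕ} (ξ : Fin n → ℂ) (m : Fin n → ℕ) : ℂ → ℂ :=
  fun z => ∏ j, (z - ξ j) ^ (m j)

/-- A decomposition `f = a₁ g + q` with `g ∈ H²`, `deg q ≤ N − 1`, witnessing membership
in `H(b) = a₁H² ⊕ P_{N−1}`. -/
def HbDecompOf {n : ℕ} (ξ : Fin n → ℂ) (m : Fin n → ℕ)
    (f g : ℂ → ℂ) (q : Polynomial ℂ) : Prop :=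
  MemH2 g ∧ q.degree < ((∑ j, m j : ℕ) : WithBot ℕ) ∧
    ∀ z ∈ unitDisk, f z = a1fun ξ m z * g z + q.eval z

/-- Membership in `H(b) = a₁ H² ⊕ P_{N−1}` (description of `H(b)` for `b` rational,
not a finite Blaschke product, whose pythagorean mate has boundary zeros `ξ` with
multiplicities `m`). -/
def MemHb {n : ℕ} (ξ : Fin n → ℂ) (m : Fin n → ℕ) (f : ℂ → ℂ) : Prop :=
  ∃ gq : (ℂ → ℂ) × Polynomial ℂ, HbDecompOf ξ m f gq.1 gq.2

/-- The (unique) decomposition of a member of `H(b)`. -/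
def hbDecomp {n : ℕ} (ξ : Fin n → ℂ) (m : Fin n → ℕ) (f : ℂ → ℂ) :
    (ℂ → ℂ) × Polynomial ℂ :=
  if h : MemHb ξ m f then h.choose else (0, 0)

/-- The squared norm `⦀a₁g + q⦀² = ‖g‖²_{H²} + ‖q‖²_{H²}` on `H(b)`. -/
def hbNormSq {n : ℕ} (ξ : Fin n → ℂ) (m : Fin n → ℕ) (f : ℂ → ℂ) : ℝ :=
  h2NormSq (hbDecomp ξ m f).1 + h2NormSq fun z => ((hbDecomp ξ m f).2).eval z

/-- The inner product on `H(b)` induced by the decomposition. -/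
def hbInner {n : ℕ} (ξ : Fin n → ℂ) (m : Fin n → ℕ) (f g : ℂ → ℂ) : ℂ :=
  h2Inner (hbDecomp ξ m f).1 (hbDecomp ξ m g).1 +
    h2Inner (fun z => ((hbDecomp ξ m f).2).eval z)
      (fun z => ((hbDecomp ξ m g).2).eval z)

/-- The Stolz angle (non-tangential approach region) at a boundary point `ξ`. -/
def stolzAngle (ξ : ℂ) (M : ℝ) : Set ℂ := {z ∈ unitDisk | ‖z - ξ‖ ≤ M * (1 - ‖z‖)}

/-- `f` has non-tangential limit `L` at `ξ`. -/
def NTLimit (f : ℂ → ℂ) (ξ L : ℂ) : Prop :=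
  ∀ M : ℝ, 1 < M → Tendsto f (nhdsWithin ξ (stolzAngle ξ M)) (nhds L)

/-- Radial boundary value of `f` at `ζ` (junk value if the radial limit does not exist). -/
def bdryVal (f : ℂ → ℂ) (ζ : ℂ) : ℂ :=
  limUnder (nhdsWithin (1:ℝ) (Set.Iio 1)) fun r : ℝ => f ((r : ℂ) * ζ)

/-- The full setting: `b` is a rational function in the closed unit ball of `H^∞` with
`‖b‖_∞ = 1` which is not a finite Blaschke product; `a` is its pythagorean mate (rational,
outer — i.e. zero-free on the disk —, `a(0) > 0`, `|a|² + |b|² = 1` on the circle); the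
`ξ j` are the distinct zeros of `a` on the unit circle, with multiplicities `m j`. -/
structure RationalSetting (b a : ℂ → ℂ) (n : ℕ) (ξ : Fin n → ℂ) (m : Fin n → ℕ) :
    Prop where
  b_diff : DifferentiableOn ℂ b unitDisk
  b_rat : IsRationalOnDisk b
  b_le_one : ∀ z ∈ unitDisk, ‖b z‖ ≤ 1
  b_norm_one : sSup ((fun z => ‖b z‖) '' unitDisk) = 1
  b_not_fbp : ¬ IsFiniteBlaschke b
  a_diff : DifferentiableOn ℂ a unitDisk
  a_rat : IsRationalOnDisk a
  a_outer : ∀ z ∈ unitDisk, a z ≠ 0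
  a_zero_pos : 0 < (a 0).re ∧ (a 0).im = 0
  pyth : ∀ ζ ∈ unitCircle, ‖a ζ‖ ^ 2 + ‖b ζ‖ ^ 2 = 1
  zeros_mem : ∀ j, ξ j ∈ unitCircle
  zeros_inj : Function.Injective ξ
  mult_pos : ∀ j, 0 < m j
  factor : ∃ g : ℂ → ℂ, IsRationalOnDisk g ∧ (∀ ζ ∈ unitCircle, g ζ ≠ 0) ∧
    ∀ z ∈ Metric.closedBall (0:ℂ) 1, a z = a1fun ξ m z * g z

/-- The composition operator `C_φ` maps `H(b)` into itself and is bounded there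
(with respect to the equivalent norm `⦀·⦀_b`). -/
def CompBddHb {n : ℕ} (ξ : Fin n → ℂ) (m : Fin n → ℕ) (φ : ℂ → ℂ) : Prop :=
  (∀ f, MemHb ξ m f → MemHb ξ m fun z => f (φ z)) ∧
  ∃ C : ℝ, ∀ f, MemHb ξ m f →
    hbNormSq ξ m (fun z => f (φ z)) ≤ C * hbNormSq ξ m f

/-- The composition operator `C_φ` is compact on `H(b)`: it is bounded and the image of
every sequence in the unit ball has a subsequence whose image converges in `H(b)`. -/
def CompCompactHb {n : ℕ} (ξ : Fin n → ℂ) (m : Fin n → ℕ) (φ : ℂ → ℂ) : Prop :=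
  CompBddHb ξ m φ ∧
  ∀ f : ℕ → ℂ → ℂ, (∀ k, MemHb ξ m (f k) ∧ hbNormSq ξ m (f k) ≤ 1) →
    ∃ (κ : ℕ → ℕ) (g : ℂ → ℂ), StrictMono κ ∧ MemHb ξ m g ∧
      Tendsto (fun i => hbNormSq ξ m fun z => f (κ i) (φ z) - g z) atTop (nhds 0)

/-- The composition operator `C_φ` is Hilbert–Schmidt on `H(b)`: it is bounded and the sum
of `⦀C_φ e⦀²` over the orthonormal basis `{a₁ z^k}ₖ ∪ {z^j}_{j<N}` of
`(H(b), ⦀·⦀_b)` is finite (the finite part of the sum being automatically finite). -/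
def CompHSHb {n : ℕ} (ξ : Fin n → ℂ) (m : Fin n → ℕ) (φ : ℂ → ℂ) : Prop :=
  CompBddHb ξ m φ ∧
  Summable fun k : ℕ => hbNormSq ξ m fun z => a1fun ξ m (φ z) * φ z ^ k

/-- The weighted composition operator `W_{u,φ} f = u · (f ∘ φ)` maps `H²` boundedly
into itself. -/
def WCompBddH2 (u φ : ℂ → ℂ) : Prop :=
  (∀ f, MemH2 f → MemH2 fun z => u z * f (φ z)) ∧
  ∃ C : ℝ, ∀ f, MemH2 f →
    h2NormSq (fun z => u z * f (φ z)) ≤ C * h2NormSq f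

/-- The weighted composition operator `W_{u,φ}` is compact on `H²`. -/
def WCompCompactH2 (u φ : ℂ → ℂ) : Prop :=
  WCompBddH2 u φ ∧
  ∀ f : ℕ → ℂ → ℂ, (∀ k, MemH2 (f k) ∧ h2NormSq (f k) ≤ 1) →
    ∃ (κ : ℕ → ℕ) (g : ℂ → ℂ), StrictMono κ ∧ MemH2 g ∧
      Tendsto (fun i => h2NormSq fun z => u z * f (κ i) (φ z) - g z) atTop (nhds 0)

/-- The weighted composition operator `W_{u,φ}` is Hilbert–Schmidt on `H²`
(sum over the orthonormal basis `{z^k}` of `H²`). -/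
def WCompHSH2 (u φ : ℂ → ℂ) : Prop :=
  WCompBddH2 u φ ∧ Summable fun k : ℕ => h2NormSq fun z => u z * φ z ^ k

/-- The function `u = (a₁ ∘ φ) · ∏_{j ≥ p} (φ − φ(ξⱼ))^{mⱼ} / a₁`, where `Λ j = φ(ξ j)`
are the non-tangential limits of `φ` at the zeros of the mate. -/
def ufun {n : ℕ} (p : ℕ) (ξ : Fin n → ℂ) (m : Fin n → ℕ) (Λ : Fin n → ℂ)
    (φ : ℂ → ℂ) : ℂ → ℂ :=
  fun z => a1fun ξ m (φ z) *
    (∏ j ∈ Finset.univ.filter fun j : Fin n => p ≤ (j : ℕ), (φ z - Λ j) ^ (m j)) /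
      a1fun ξ m z

/-- The reproducing kernel of the de Branges–Rovnyak space `H(c)`:
`k_λ^c(z) = (1 − conj(c(λ)) c(z)) / (1 − conj(λ) z)`, as a function of the parameter `λ`
and the evaluation point `z`. -/
def rkKernel (c : ℂ → ℂ) (lam z : ℂ) : ℂ :=
  (1 - (starRingEnd ℂ) (c lam) * c z) / (1 - (starRingEnd ℂ) lam * z)

/-- `f` belongs to the reproducing kernel Hilbert space `H(c)` with squared norm at
most `t`: for all finite linear combinations of kernels,
`|⟨f, Σ αᵢ k_{λᵢ}⟩|² ≤ t · ‖Σ αᵢ k_{λᵢ}‖²`. -/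
def HbRKBound (c f : ℂ → ℂ) (t : ℝ) : Prop :=
  ∀ (k : ℕ) (lam α : Fin k → ℂ), (∀ i, lam i ∈ unitDisk) →
    ‖∑ i, (starRingEnd ℂ) (α i) * f (lam i)‖ ^ 2 ≤
      t * (∑ i, ∑ j, α i * (starRingEnd ℂ) (α j) * rkKernel c (lam i) (lam j)).re

/-- Membership in the de Branges–Rovnyak space `H(c)` (general RKHS definition). -/
def MemHbRK (c f : ℂ → ℂ) : Prop := ∃ t : ℝ, HbRKBound c f t

/-- `φ` has an angular derivative in the sense of Carathéodory at `ξ`: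
`φ` and `φ'` have non-tangential limits at `ξ` and `|φ(ξ)| = 1`. -/
def HasADC (φ : ℂ → ℂ) (ξ : ℂ) : Prop :=
  ∃ L L' : ℂ, ‖L‖ = 1 ∧ NTLimit φ ξ L ∧ NTLimit (deriv φ) ξ L'

/-- The measure `μ_{u,φ}(E) = ∫_{φ⁻¹(E) ∩ T} |u|² dm` (boundary values on the circle,
normalized Lebesgue measure). -/
def muMeas (u φ : ℂ → ℂ) (E : Set ℂ) : ENNReal :=
  (ENNReal.ofReal (2 * Real.pi))⁻¹ *
    ∫⁻ θ in Set.Ioc (0:ℝ) (2 * Real.pi),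
      (if bdryVal φ (Complex.exp (θ * Complex.I)) ∈ E then
        ENNReal.ofReal (‖bdryVal u (Complex.exp (θ * Complex.I))‖ ^ 2) else 0)

/-- `μ_{u,φ}` is a Carleson measure: `μ(S(ζ,r)) ≤ M r` for all Carleson windows
`S(ζ,r) = {z : |z| ≤ 1, |z − ζ| ≤ r}`, `ζ ∈ T`, `0 < r < 1`. -/
def IsCarleson (u φ : ℂ → ℂ) : Prop :=
  ∃ M : ℝ, 0 < M ∧ ∀ ζ ∈ unitCircle, ∀ r ∈ Set.Ioo (0:ℝ) 1,
    muMeas u φ (Metric.closedBall ζ r ∩ Metric.closedBall 0 1) ≤ ENNReal.ofReal (M * r)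

/-- `μ_{u,φ}` is a vanishing Carleson measure: `sup_{ζ∈T} μ(S(ζ,r))/r → 0` as `r → 0`. -/
def IsVanishingCarleson (u φ : ℂ → ℂ) : Prop :=
  ∀ ε > (0:ℝ), ∃ r₀ ∈ Set.Ioo (0:ℝ) 1, ∀ r ∈ Set.Ioo (0:ℝ) r₀, ∀ ζ ∈ unitCircle,
    muMeas u φ (Metric.closedBall ζ r ∩ Metric.closedBall 0 1) ≤ ENNReal.ofReal (ε * r)

/-- The reproducing kernel integral
`∫_T (1 − |w|²) |u(ξ)|² / |1 − conj(w) φ(ξ)|² dm(ξ)`. -/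
def repKerInt (u φ : ℂ → ℂ) (w : ℂ) : ENNReal :=
  (ENNReal.ofReal (2 * Real.pi))⁻¹ *
    ∫⁻ θ in Set.Ioc (0:ℝ) (2 * Real.pi),
      ENNReal.ofReal ((1 - ‖w‖ ^ 2) * ‖bdryVal u (Complex.exp (θ * Complex.I))‖ ^ 2 /
        ‖1 - (starRingEnd ℂ) w * bdryVal φ (Complex.exp (θ * Complex.I))‖ ^ 2)

lemma mem_uD {z : ℂ} : z ∈ unitDisk ↔ ‖z‖ < 1 := by simp [unitDisk]

lemma isOpen_uD : IsOpen unitDisk := Metric.isOpen_ball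

lemma hasSum_tay {f : ℂ → ℂ} (hf : DifferentiableOn ℂ f unitDisk) {z : ℂ} (hz : ‖z‖ < 1) :
    HasSum (fun k => taylorCoeff f k * z ^ k) (f z) := by
  have h := Complex.hasSum_taylorSeries_on_ball (f := f) (c := 0) (r := 1) (z := z)
    (by simpa [unitDisk] using hf) (by simpa using hz)
  have e : (fun k => taylorCoeff f k * z ^ k) =
      fun n : ℕ => (n.factorial : ℂ)⁻¹ • (z - 0) ^ n • iteratedDeriv n f 0 := by
    funext k
    simp [taylorCoeff, smul_eq_mul]
    ring
  rw [e]
  exact h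

lemma summable_norm_tay {f : ℂ → ℂ} (hf : DifferentiableOn ℂ f unitDisk) {r : ℝ}
    (h0 : 0 ≤ r) (h1 : r < 1) : Summable (fun k => ‖taylorCoeff f k‖ * r ^ k) := by
  have h := (hasSum_tay hf (z := (r : ℂ)) (by simpa [abs_of_nonneg h0] using h1)).summable.norm
  simpa [abs_of_nonneg h0] using h

/-- circle mean of the squared modulus -/
def avg (f : ℂ → ℂ) (r : ℝ) : ℝ := Real.circleAverage (fun z => ‖f z‖ ^ 2) 0 r

lemma parseval {f : ℂ → ℂ} (hf : DifferentiableOn ℂ f unitDisk) {r : ℝ}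
    (h0 : 0 ≤ r) (h1 : r < 1) :
    HasSum (fun k => ‖taylorCoeff f k‖ ^ 2 * r ^ (2 * k)) (avg f r) := by
  rw [hasSum_iff_tendsto_nat_of_nonneg (fun k => by positivity)]
  let P : ℕ → Polynomial ℂ := fun K =>
    ∑ k ∈ Finset.range K, Polynomial.monomial k (taylorCoeff f k * (r : ℂ) ^ k)
  have hc : ∀ K j, (P K).coeff j = if j < K then taylorCoeff f j * (r : ℂ) ^ j else 0 := by
    intro K j
    simp [P, Polynomial.finsetSum_coeff, Polynomial.coeff_monomial]
  have hP : ∀ K, ∑ k ∈ Finset.range K, ‖taylorCoeff f k‖ ^ 2 * r ^ (2 * k)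
      = Real.circleAverage (fun θ ↦ ‖(P K).eval θ‖ ^ 2) 0 1 := by
    intro K
    rw [← Polynomial.sum_sq_norm_coeff_eq_circleAverage]
    rw [Finset.sum_subset (s₁ := (P K).support) (s₂ := Finset.range K)]
    · refine Finset.sum_congr rfl fun k hk => ?_
      rw [hc, if_pos (Finset.mem_range.1 hk)]
      simp [abs_of_nonneg h0, mul_pow, ← pow_mul, mul_comm]
    · intro j hj
      rw [Polynomial.mem_support_iff, hc] at hj
      simp only [Finset.mem_range]
      by_contra h
      simp [h] at hj
    · intro j _ hj
      rw [Polynomial.notMem_support_iff] at hj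
      simp [hj]
  simp_rw [hP]
  have e : avg f r = Real.circleAverage (fun z => ‖f (r * z)‖ ^ 2) 0 1 := by
    rw [avg, Real.circleAverage_eq_circleAverage_zero_one]
    simp
  rw [e]
  simp only [Real.circleAverage]
  apply Tendsto.const_smul
  set B := ∑' k, ‖taylorCoeff f k‖ * r ^ k
  have hS := summable_norm_tay hf h0 h1
  apply intervalIntegral.tendsto_integral_filter_of_dominated_convergence (fun _ => B ^ 2)
  · refine Eventually.of_forall fun K => ?_
    apply Continuous.aestronglyMeasurable
    fun_prop
  · refine Eventually.of_forall fun K => Eventually.of_forall fun θ _ => ?_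
    rw [Real.norm_of_nonneg (by positivity)]
    gcongr
    simp only [P, Polynomial.eval_finsetSum, Polynomial.eval_monomial]
    refine (norm_sum_le _ _).trans ?_
    refine le_trans (le_of_eq ?_) (hS.sum_le_tsum (Finset.range K) (fun k _ => by positivity))
    refine Finset.sum_congr rfl fun k _ => ?_
    simp [abs_of_nonneg h0]
  · simp
  · refine Eventually.of_forall fun θ _ => ?_
    apply Tendsto.pow
    apply Tendsto.norm
    have := (hasSum_tay hf (z := r * circleMap 0 1 θ)
      (by simpa [abs_of_nonneg h0] using h1)).tendsto_sum_nat
    refine this.congr fun K => ?_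
    simp only [P, Polynomial.eval_finsetSum, Polynomial.eval_monomial]
    refine Finset.sum_congr rfl fun k _ => ?_
    ring

lemma avg_le {f : ℂ → ℂ} (hf : MemH2 f) {r : ℝ} (h0 : 0 ≤ r) (h1 : r < 1) :
    avg f r ≤ h2NormSq f := by
  rw [← (parseval hf.1 h0 h1).tsum_eq]
  refine (parseval hf.1 h0 h1).summable.tsum_le_tsum (fun k => ?_) hf.2
  exact mul_le_of_le_one_right (by positivity) (pow_le_one₀ h0 h1.le)

lemma memH2_of_avg {f : ℂ → ℂ} (hf : DifferentiableOn ℂ f unitDisk) {ρ C : ℝ} (hρ : ρ < 1)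
    (h : ∀ r, ρ < r → 0 < r → r < 1 → avg f r ≤ C) : MemH2 f ∧ h2NormSq f ≤ C := by
  have key : ∀ s : Finset ℕ, ∑ k ∈ s, ‖taylorCoeff f k‖ ^ 2 ≤ C := by
    intro s
    have ht : Tendsto (fun r : ℝ => ∑ k ∈ s, ‖taylorCoeff f k‖ ^ 2 * r ^ (2 * k))
        (nhdsWithin 1 (Iio 1)) (nhds (∑ k ∈ s, ‖taylorCoeff f k‖ ^ 2)) := by
      have : Continuous (fun r : ℝ => ∑ k ∈ s, ‖taylorCoeff f k‖ ^ 2 * r ^ (2 * k)) := by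
        fun_prop
      have h2 := this.tendsto 1
      simp only [one_pow, mul_one] at h2
      exact h2.mono_left nhdsWithin_le_nhds
    refine le_of_tendsto ht ?_
    have h3 : ∀ᶠ r : ℝ in nhdsWithin 1 (Iio 1), max ρ 0 < r ∧ r < 1 :=
      Filter.Eventually.and (nhdsWithin_le_nhds (lt_mem_nhds (by simp [hρ])))
        self_mem_nhdsWithin
    filter_upwards [h3] with r hr
    have hr0 : 0 < r := lt_of_le_of_lt (le_max_right _ _) hr.1
    refine le_trans ?_ (h r (lt_of_le_of_lt (le_max_left _ _) hr.1) hr0 hr.2)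
    exact sum_le_hasSum s (fun k _ => by positivity) (parseval hf hr0.le hr.2)
  have hs : Summable fun k => ‖taylorCoeff f k‖ ^ 2 :=
    summable_of_sum_le (fun k => by positivity) key
  exact ⟨⟨hf, hs⟩, hs.tsum_le_of_sum_le key⟩

lemma h2NormSq_nonneg (f : ℂ → ℂ) : 0 ≤ h2NormSq f := tsum_nonneg fun _ => by positivity

lemma coeff_le {f : ℂ → ℂ} (hf : MemH2 f) (k : ℕ) : ‖taylorCoeff f k‖ ^ 2 ≤ h2NormSq f :=
  hf.2.le_tsum k (fun _ _ => by positivity)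

/-- growth estimate -/
lemma growth {f : ℂ → ℂ} (hf : MemH2 f) {z : ℂ} (hz : ‖z‖ < 1) :
    ‖f z‖ ^ 2 * (1 - ‖z‖) ≤ h2NormSq f := by
  have hs := hasSum_tay hf.1 hz
  have h1 : Tendsto (fun K => ‖∑ k ∈ Finset.range K, taylorCoeff f k * z ^ k‖ ^ 2 * (1 - ‖z‖))
      atTop (nhds (‖f z‖ ^ 2 * (1 - ‖z‖))) :=
    (hs.tendsto_sum_nat.norm.pow 2).mul_const _
  refine le_of_tendsto h1 (Eventually.of_forall fun K => ?_)
  have h2 : ‖∑ k ∈ Finset.range K, taylorCoeff f k * z ^ k‖ ^ 2 ≤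
      (∑ k ∈ Finset.range K, ‖taylorCoeff f k‖ ^ 2) *
      (∑ k ∈ Finset.range K, (‖z‖ ^ k) ^ 2) := by
    refine le_trans ?_ (Finset.sum_mul_sq_le_sq_mul_sq _ _ _)
    gcongr
    refine (norm_sum_le _ _).trans (le_of_eq ?_)
    simp
  have h3 : ∑ k ∈ Finset.range K, ‖taylorCoeff f k‖ ^ 2 ≤ h2NormSq f :=
    hf.2.sum_le_tsum _ (fun _ _ => by positivity)
  have h4 : (∑ k ∈ Finset.range K, (‖z‖ ^ k) ^ 2) * (1 - ‖z‖) ≤ 1 := by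
    have : (∑ k ∈ Finset.range K, (‖z‖ ^ k) ^ 2) ≤ ∑ k ∈ Finset.range K, ‖z‖ ^ k := by
      refine Finset.sum_le_sum fun k _ => ?_
      rw [sq]
      exact mul_le_of_le_one_left (by positivity) (pow_le_one₀ (norm_nonneg _) hz.le)
    have h5 := geom_sum_mul_neg ‖z‖ K
    calc _ ≤ (∑ k ∈ Finset.range K, ‖z‖ ^ k) * (1 - ‖z‖) := by
          have : 0 ≤ 1 - ‖z‖ := by linarith
          gcongr
      _ = 1 - ‖z‖ ^ K := h5
      _ ≤ 1 := by have : 0 ≤ ‖z‖ ^ K := by positivity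
                  linarith
  have hz' : 0 ≤ 1 - ‖z‖ := by linarith
  calc _ ≤ ((∑ k ∈ Finset.range K, ‖taylorCoeff f k‖ ^ 2) *
      (∑ k ∈ Finset.range K, (‖z‖ ^ k) ^ 2)) * (1 - ‖z‖) := by gcongr
    _ = (∑ k ∈ Finset.range K, ‖taylorCoeff f k‖ ^ 2) *
      ((∑ k ∈ Finset.range K, (‖z‖ ^ k) ^ 2) * (1 - ‖z‖)) := by ring
    _ ≤ (∑ k ∈ Finset.range K, ‖taylorCoeff f k‖ ^ 2) * 1 := by
        gcongr
    _ ≤ _ := by linarith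

lemma circInt {f : ℂ → ℂ} (hf : DifferentiableOn ℂ f unitDisk) {r : ℝ} (h0 : 0 ≤ r) (h1 : r < 1) :
    Continuous (fun θ : ℝ => f (circleMap 0 r θ)) := by
  have : ∀ θ, circleMap 0 r θ ∈ unitDisk := fun θ => by simp [mem_uD, abs_of_nonneg h0, h1]
  exact hf.continuousOn.comp_continuous (continuous_circleMap 0 r) this

lemma circInt' {f : ℂ → ℂ} (hf : DifferentiableOn ℂ f unitDisk) {r : ℝ} (h0 : 0 ≤ r) (h1 : r < 1) :
    CircleIntegrable (fun z => ‖f z‖ ^ 2) 0 r := by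
  apply Continuous.intervalIntegrable
  exact (circInt hf h0 h1).norm.pow 2

/-- comparison principle for `H²` membership -/
lemma memH2_of_le {f g : ℂ → ℂ} (hf : DifferentiableOn ℂ f unitDisk) (hg : MemH2 g)
    {ρ A B : ℝ} (hρ : ρ < 1) (hA : 0 ≤ A)
    (h : ∀ z, ρ < ‖z‖ → ‖z‖ < 1 → ‖f z‖ ^ 2 ≤ A * ‖g z‖ ^ 2 + B) :
    MemH2 f ∧ h2NormSq f ≤ A * h2NormSq g + B := by
  refine memH2_of_avg hf hρ fun r hr hr0 hr1 => ?_
  have hi := circInt' hg.1 hr0.le hr1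
  have e : Real.circleAverage (fun z => A * ‖g z‖ ^ 2 + B) 0 r = A * avg g r + B := by
    have h2 := Real.circleAverage_fun_add (c := 0) (R := r) (f₁ := fun z => A • ‖g z‖ ^ 2)
      (f₂ := fun _ => B) (hi.const_smul) (circleIntegrable_const _ _ _)
    simp only [Real.circleAverage_const, Real.circleAverage_fun_smul] at h2
    exact h2
  have h3 : avg f r ≤ A * avg g r + B := by
    rw [← e]
    refine Real.circleAverage_mono (circInt' hf hr0.le hr1) ?_ ?_
    · exact (hi.const_smul (a := A)).add (circleIntegrable_const _ _ _)
    · intro z hz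
      have : ‖z‖ = r := by simpa [abs_of_pos hr0] using hz
      exact h z (by rw [this]; exact hr) (by rw [this]; exact hr1)
  refine h3.trans ?_
  gcongr
  exact avg_le hg hr0.le hr1

/-- Poisson type kernel for the derivative. -/
def Kder (r : ℝ) (w : ℂ) : ℂ := ((w - r) ^ 2)⁻¹ - (r : ℂ) ^ 2 * ((r * w - 1) ^ 2)⁻¹

lemma deriv_formula {W : ℂ → ℂ} (hc : ContinuousOn W (Metric.closedBall 0 1))
    (hd : DifferentiableOn ℂ W unitDisk) {r : ℝ} (h0 : 0 < r) (h1 : r < 1) :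
    (∮ w in C(0, 1), Kder r w * W w) = 2 * Real.pi * I * deriv W r := by
  have hr : (r : ℂ) ∈ Metric.ball (0:ℂ) 1 := by simp [abs_of_pos h0, h1]
  have hnr : Metric.ball (0:ℂ) 1 ∈ nhds (r:ℂ) := Metric.isOpen_ball.mem_nhds hr
  have hnr' : Metric.closedBall (0:ℂ) 1 ∈ nhds (r:ℂ) :=
    mem_of_superset hnr Metric.ball_subset_closedBall
  have hda : DifferentiableAt ℂ W r := hd.differentiableAt hnr
  have hG : DiffContOnCl ℂ (dslope W r) (Metric.ball 0 1) := by
    refine ⟨(Complex.differentiableOn_dslope hnr).2 hd, ?_⟩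
    rw [closure_ball _ one_ne_zero]
    exact (continuousOn_dslope hnr').2 ⟨hc, hda⟩
  have hW : DiffContOnCl ℂ W (Metric.ball 0 1) := ⟨hd, by rwa [closure_ball _ one_ne_zero]⟩
  have e1 := hG.circleIntegral_sub_inv_smul hr
  rw [dslope_same] at e1
  have hsph : ∀ w ∈ Metric.sphere (0:ℂ) 1, w - r ≠ 0 := by
    intro w hw h
    rw [sub_eq_zero] at h
    rw [h] at hw
    simp [abs_of_pos h0] at hw
    linarith
  have hout : ∀ w ∈ Metric.closedBall (0:ℂ) 1, r * w - 1 ≠ 0 := by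
    intro w hw h
    rw [sub_eq_zero] at h
    have h2 : ‖(r:ℂ) * w‖ = 1 := by rw [h]; simp
    simp [abs_of_pos h0] at h2
    have h3 : ‖w‖ ≤ 1 := by simpa using hw
    nlinarith [norm_nonneg w]
  have hcs : ContinuousOn W (Metric.sphere 0 1) := hc.mono Metric.sphere_subset_closedBall
  have e2 : (∮ w in C(0, 1), (w - (r:ℂ))⁻¹ • dslope W r w) =
      (∮ w in C(0, 1), ((w - (r:ℂ)) ^ 2)⁻¹ * W w) - W r * ∮ w in C(0, 1), (w - (r:ℂ)) ^ (-2 : ℤ) := by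
    rw [← circleIntegral.integral_const_mul, ← circleIntegral.integral_sub]
    · refine circleIntegral.integral_congr zero_le_one fun w hw => ?_
      have hne : w ≠ r := sub_ne_zero.1 (hsph w hw)
      simp only [dslope_of_ne _ hne, slope, vsub_eq_sub, smul_eq_mul]
      rw [zpow_neg]
      norm_cast
      field_simp
    · apply ContinuousOn.circleIntegrable zero_le_one
      refine ContinuousOn.mul (ContinuousOn.inv₀ (by fun_prop) ?_) hcs
      intro w hw
      exact pow_ne_zero _ (hsph w hw)
    · apply ContinuousOn.circleIntegrable zero_le_one
      refine ContinuousOn.mul continuousOn_const (ContinuousOn.zpow₀ (by fun_prop) _ ?_)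
      intro w hw
      exact Or.inl (hsph w hw)
  rw [circleIntegral.integral_sub_zpow_of_ne (by norm_num), mul_zero, sub_zero] at e2
  have e3 : (∮ w in C(0, 1), ((r : ℂ) ^ 2 * ((r * w - 1) ^ 2)⁻¹) * W w) = 0 := by
    apply DiffContOnCl.circleIntegral_eq_zero zero_le_one
    refine ⟨?_, ?_⟩
    · refine DifferentiableOn.mul (DifferentiableOn.const_mul (DifferentiableOn.inv (by fun_prop) ?_) _) hd
      intro w hw
      exact pow_ne_zero _ (hout w (Metric.ball_subset_closedBall hw))
    · rw [closure_ball _ one_ne_zero]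
      refine ContinuousOn.mul (ContinuousOn.mul continuousOn_const (ContinuousOn.inv₀ (by fun_prop) ?_)) hc
      intro w hw
      exact pow_ne_zero _ (hout w hw)
  have e4 : (∮ w in C(0, 1), Kder r w * W w) = (∮ w in C(0, 1), ((w - (r:ℂ)) ^ 2)⁻¹ * W w) -
      ∮ w in C(0, 1), ((r : ℂ) ^ 2 * ((r * w - 1) ^ 2)⁻¹) * W w := by
    rw [← circleIntegral.integral_sub]
    · simp only [Kder, sub_mul]
    · apply ContinuousOn.circleIntegrable zero_le_one
      refine ContinuousOn.mul (ContinuousOn.inv₀ (by fun_prop) ?_) hcs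
      intro w hw
      exact pow_ne_zero _ (hsph w hw)
    · apply ContinuousOn.circleIntegrable zero_le_one
      refine ContinuousOn.mul (ContinuousOn.mul continuousOn_const (ContinuousOn.inv₀ (by fun_prop) ?_)) hcs
      intro w hw
      exact pow_ne_zero _ (hout w (Metric.sphere_subset_closedBall hw))
  rw [e4, e3, sub_zero, ← e2, e1]
  simp

lemma dist_sq_circle (r t : ℝ) : ‖exp (t * I) - r‖ ^ 2 = (1 - r) ^ 2 + 2 * r * (1 - Real.cos t) := by
  rw [← normSq_eq_norm_sq, normSq_apply]
  simp [exp_ofReal_mul_I_re, exp_ofReal_mul_I_im]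
  nlinarith [Real.sin_sq_add_cos_sq t]

lemma dist_lower {r t : ℝ} (hr : 1 / 2 ≤ r) (ht : |t| ≤ Real.pi) :
    (1 - r) ^ 2 + t ^ 2 ≤ 9 * ‖exp (t * I) - r‖ ^ 2 := by
  rw [dist_sq_circle]
  have h := Real.cos_le_one_sub_mul_cos_sq ht
  have hpi : Real.pi ^ 2 ≤ 10 := by
    have := Real.pi_lt_d2
    have := Real.pi_pos
    nlinarith
  have h2 : 1 / 5 * t ^ 2 ≤ 2 / Real.pi ^ 2 * t ^ 2 := by
    have h4 : (1:ℝ) / 5 ≤ 2 / Real.pi ^ 2 := by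
      rw [le_div_iff₀ (by positivity)]
      linarith
    exact mul_le_mul_of_nonneg_right h4 (sq_nonneg t)
  have h3 : 1 / 5 * t ^ 2 ≤ 1 - Real.cos t := by linarith
  nlinarith [sq_nonneg (1 - r), sq_nonneg t]

lemma Kder_norm {r t : ℝ} (h0 : 0 < r) (h1 : r < 1) :
    ‖Kder r (exp (t * I))‖ * ‖exp (t * I) - r‖ ^ 3 ≤ 4 * (1 - r) := by
  set w := exp (t * I) with hw
  have hwn : ‖w‖ = 1 := by rw [hw]; exact norm_exp_ofReal_mul_I t
  have hd : w - r ≠ 0 := by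
    intro h
    rw [sub_eq_zero] at h
    rw [h] at hwn
    simp [abs_of_pos h0] at hwn
    linarith
  have hn : ‖(r:ℂ) * w - 1‖ = ‖w - r‖ := by
    have e : ‖(r:ℂ) * w - 1‖ ^ 2 = ‖w - r‖ ^ 2 := by
      have h2 : w.re ^ 2 + w.im ^ 2 = 1 := by
        have := normSq_eq_norm_sq w
        rw [hwn, normSq_apply] at this
        nlinarith
      rw [← normSq_eq_norm_sq, ← normSq_eq_norm_sq, normSq_apply, normSq_apply]
      simp
      linear_combination (r ^ 2 - 1) * h2
    exact (pow_left_inj₀ (norm_nonneg _) (norm_nonneg _) two_ne_zero).1 e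
  have hd2 : (r:ℂ) * w - 1 ≠ 0 := by
    rw [← norm_ne_zero_iff, hn, norm_ne_zero_iff]
    exact hd
  have e : Kder r w * (w - r) ^ 2 * (r * w - 1) ^ 2 =
      - (1 - (r:ℂ) ^ 2) * ((r * w - 1) + r * (w - r)) := by
    have gen : ∀ A B : ℂ, A ≠ 0 → B ≠ 0 →
        ((A ^ 2)⁻¹ - (r : ℂ) ^ 2 * (B ^ 2)⁻¹) * A ^ 2 * B ^ 2 = B ^ 2 - (r : ℂ) ^ 2 * A ^ 2 := by
      intro A B hA hB
      field_simp
    rw [Kder, gen _ _ hd hd2]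
    ring
  have e2 := congrArg norm e
  rw [norm_mul, norm_mul, norm_mul, norm_pow, norm_pow, hn, norm_neg] at e2
  set d := ‖w - r‖ with hdd
  have hdpos : 0 < d := norm_pos_iff.2 hd
  have h3 : ‖(1 - (r:ℂ) ^ 2)‖ = 1 - r ^ 2 := by
    have : (1 - (r:ℂ) ^ 2) = ((1 - r ^ 2 : ℝ) : ℂ) := by push_cast; ring
    rw [this, norm_real, Real.norm_of_nonneg (by nlinarith)]
  have h4 : ‖(r * w - 1) + r * (w - r)‖ ≤ 2 * d := by
    refine (norm_add_le _ _).trans ?_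
    rw [hn, norm_mul, norm_real, Real.norm_of_nonneg h0.le]
    nlinarith
  rw [h3] at e2
  have h5 : (‖Kder r w‖ * d ^ 3) * d ≤ (4 * (1 - r)) * d := by
    calc (‖Kder r w‖ * d ^ 3) * d = ‖Kder r w‖ * d ^ 2 * d ^ 2 := by ring
      _ = (1 - r ^ 2) * ‖(r * w - 1) + r * (w - r)‖ := e2
      _ ≤ (1 - r ^ 2) * (2 * d) := by
          have : 0 ≤ 1 - r ^ 2 := by nlinarith
          gcongr
      _ ≤ (4 * (1 - r)) * d := by nlinarith [mul_pos (sub_pos.2 h1) hdpos, mul_pos (mul_pos (sub_pos.2 h1) hdpos) h0]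
  exact le_of_mul_le_mul_right h5 hdpos

lemma integral_lorentz {s : ℝ} (hs : 0 < s) :
    IntervalIntegrable (fun t => s / (s ^ 2 + t ^ 2)) volume (-Real.pi) Real.pi ∧
    ∫ t in (-Real.pi)..Real.pi, s / (s ^ 2 + t ^ 2) ≤ Real.pi := by
  have hi : IntervalIntegrable (fun t => s / (s ^ 2 + t ^ 2)) volume (-Real.pi) Real.pi := by
    apply Continuous.intervalIntegrable
    refine Continuous.div (by fun_prop) (by fun_prop) fun t => by positivity
  refine ⟨hi, ?_⟩
  rw [intervalIntegral.integral_eq_sub_of_hasDerivAt (f := fun t => Real.arctan (t / s)) _ hi]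
  · have h1 := Real.arctan_lt_pi_div_two (Real.pi / s)
    have h2 := Real.neg_pi_div_two_lt_arctan (-Real.pi / s)
    linarith
  · intro t _
    have := ((hasDerivAt_id t).div_const s).arctan
    refine this.congr_deriv ?_
    simp only [id]
    field_simp

lemma deriv_tendsto_zero {W : ℂ → ℂ} (hc : ContinuousOn W (Metric.closedBall 0 1))
    (hd : DifferentiableOn ℂ W unitDisk) (hW1 : W 1 = 0)
    (hW : HasDerivAt (fun t : ℝ => W (exp (t * I))) 0 0) :
    Tendsto (fun r : ℝ => deriv W r) (nhdsWithin 1 (Iio 1)) (nhds 0) := by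
  obtain ⟨B, hB⟩ := (isCompact_closedBall (0:ℂ) 1).exists_bound_of_continuousOn hc
  have hB0 : 0 ≤ B := (norm_nonneg _).trans (hB 0 (by simp))
  -- main inequality
  have main : ∀ ε > 0, ∃ C : ℝ, ∀ r : ℝ, 1 / 2 ≤ r → r < 1 →
      ‖deriv W r‖ ≤ 108 * ε + C * (1 - r) := by
    intro ε hε
    have h1 := hW.isLittleO
    rw [Asymptotics.isLittleO_iff] at h1
    obtain ⟨η, hη, h2⟩ := Metric.eventually_nhds_iff.1 (h1 hε)
    have h3 : ∀ t : ℝ, |t| < η → ‖W (exp (t * I))‖ ≤ ε * |t| := by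
      intro t ht
      have := h2 (y := t) (by simpa [Real.dist_eq] using ht)
      simpa [hW1] using this
    refine ⟨108 * B / η ^ 3, fun r hr hr1 => ?_⟩
    have hr0 : 0 < r := by linarith
    have hs : 0 < 1 - r := by linarith
    have e := deriv_formula hc hd hr0 hr1
    have hpt : ∀ t : ℝ, |t| ≤ Real.pi → ‖Kder r (exp (t * I)) * W (exp (t * I))‖ ≤
        108 * ε * ((1 - r) / ((1 - r) ^ 2 + t ^ 2)) + 108 * B / η ^ 3 * (1 - r) := by
      intro t ht
      have hl := dist_lower hr ht
      have hk := Kder_norm (t := t) hr0 hr1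
      rw [norm_mul]
      set k := ‖Kder r (exp (t * I))‖
      set d := ‖exp (t * I) - r‖ with hdd
      have hd0 : 0 < d := by
        have : 0 < 9 * d ^ 2 := lt_of_lt_of_le (by positivity) hl
        have h5 : 0 ≤ d := norm_nonneg _
        rcases h5.lt_or_eq with h | h
        · exact h
        · rw [← h] at this; norm_num at this
      have hk' : k ≤ 4 * (1 - r) / d ^ 3 := by
        rw [le_div_iff₀ (by positivity)]; exact hk
      have htd : |t| ≤ 3 * d := by
        apply abs_le_of_sq_le_sq _ (by positivity)
        nlinarith [sq_nonneg (1 - r)]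
      rcases lt_or_ge |t| η with h | h
      · have h6 : k * ‖W (exp (t * I))‖ ≤ (4 * (1 - r) / d ^ 3) * (ε * (3 * d)) := by
          have := h3 t h
          have h7 : ‖W (exp (t * I))‖ ≤ ε * (3 * d) := this.trans (by gcongr)
          gcongr
        have h8 : (4 * (1 - r) / d ^ 3) * (ε * (3 * d)) ≤
            108 * ε * ((1 - r) / ((1 - r) ^ 2 + t ^ 2)) := by
          have : (4 * (1 - r) / d ^ 3) * (ε * (3 * d)) = 108 * ε * ((1 - r) / (9 * d ^ 2)) := by
            field_simp
            ring
          rw [this]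
          gcongr
        have h9 : 0 ≤ 108 * B / η ^ 3 * (1 - r) := by positivity
        linarith
      · have h6 : k * ‖W (exp (t * I))‖ ≤ (4 * (1 - r) / d ^ 3) * B := by
          have h7 : ‖W (exp (t * I))‖ ≤ B := hB _ (by simp)
          gcongr
        have h7 : η / 3 ≤ d := by linarith
        have h8 : (4 * (1 - r) / d ^ 3) * B ≤ (4 * (1 - r) / (η / 3) ^ 3) * B := by
          gcongr
        have h10 : (4 * (1 - r) / (η / 3) ^ 3) * B = 108 * B / η ^ 3 * (1 - r) := by
          field_simp
          ring
        have h9 : 0 ≤ 108 * ε * ((1 - r) / ((1 - r) ^ 2 + t ^ 2)) := by positivity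
        linarith
    obtain ⟨hi, hle⟩ := integral_lorentz hs
    have e5 : (∮ w in C(0, 1), Kder r w * W w) =
        ∫ t in (-Real.pi)..Real.pi, (exp (t * I) * I) * (Kder r (exp (t * I)) * W (exp (t * I))) := by
      rw [circleIntegral]
      have hper : Function.Periodic (fun t : ℝ => deriv (circleMap 0 1) t •
          (Kder r (circleMap 0 1 t) * W (circleMap 0 1 t))) (2 * Real.pi) := by
        intro t
        simp only [deriv_circleMap]
        rw [periodic_circleMap 0 1 t]
      have := hper.intervalIntegral_add_eq 0 (-Real.pi)
      rw [zero_add] at this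
      rw [this]
      have e6 : -Real.pi + 2 * Real.pi = Real.pi := by ring
      rw [e6]
      simp [circleMap_zero]
    have e7 : ‖∮ w in C(0, 1), Kder r w * W w‖ ≤
        ∫ t in (-Real.pi)..Real.pi, (108 * ε * ((1 - r) / ((1 - r) ^ 2 + t ^ 2)) +
          108 * B / η ^ 3 * (1 - r)) := by
      rw [e5]
      refine intervalIntegral.norm_integral_le_of_norm_le (by linarith [Real.pi_pos]) ?_ ?_
      · refine Eventually.of_forall fun t ht => ?_
        rw [norm_mul, norm_mul, norm_exp_ofReal_mul_I, norm_I, one_mul, one_mul]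
        exact hpt t (abs_le.2 ⟨ht.1.le, ht.2⟩)
      · exact (hi.const_mul _).add intervalIntegrable_const
    rw [intervalIntegral.integral_add (hi.const_mul _) intervalIntegrable_const,
      intervalIntegral.integral_const_mul, intervalIntegral.integral_const, e] at e7
    rw [norm_mul, norm_mul, norm_mul] at e7
    simp [abs_of_pos Real.pi_pos] at e7
    have hpi := Real.pi_pos
    have h11 : 108 * ε * ∫ t in (-Real.pi)..Real.pi, (1 - r) / ((1 - r) ^ 2 + t ^ 2) ≤
      108 * ε * Real.pi := by gcongr
    have h12 : Real.pi * (2 * ‖deriv W r‖) ≤ Real.pi * (108 * ε + 2 * (108 * B / η ^ 3 * (1 - r))) := by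
      nlinarith
    have h13 := le_of_mul_le_mul_left h12 hpi
    linarith
  rw [Metric.tendsto_nhds]
  intro e he
  obtain ⟨C, hC⟩ := main (e / 216) (by positivity)
  have ht : Tendsto (fun r : ℝ => C * (1 - r)) (nhdsWithin 1 (Iio 1)) (nhds 0) := by
    have : Continuous (fun r : ℝ => C * (1 - r)) := by fun_prop
    have h := this.tendsto 1
    simp only [sub_self, mul_zero] at h
    exact h.mono_left nhdsWithin_le_nhds
  have h3 : ∀ᶠ r : ℝ in nhdsWithin 1 (Iio 1), 1 / 2 < r ∧ r < 1 :=
      Filter.Eventually.and (nhdsWithin_le_nhds (lt_mem_nhds (by norm_num)))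
        self_mem_nhdsWithin
  filter_upwards [h3, ht.eventually (gt_mem_nhds (show (0:ℝ) < e / 2 by positivity))] with r hr hr2
  rw [dist_zero_right]
  have := hC r hr.1.le hr.2
  linarith

lemma exists_prim {u : ℂ → ℂ} (hu : MemH2 u) : ∃ U : ℂ → ℂ,
    ContinuousOn U (Metric.closedBall 0 1) ∧ ∀ z, ‖z‖ < 1 → HasDerivAt U (u z) z := by
  let g : ℕ → ℂ → ℂ := fun k z => taylorCoeff u k * (z ^ (k + 1) / (k + 1))
  have hS : Summable fun k : ℕ => ‖taylorCoeff u k‖ * (1 / ((k : ℝ) + 1)) := by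
    have h1 : Summable fun k : ℕ => (1 / ((k : ℝ) + 1)) ^ 2 := by
      have := (summable_nat_add_iff 1).2 (Real.summable_one_div_nat_pow.2 (show 1 < 2 by norm_num))
      refine this.congr fun k => ?_
      push_cast
      rw [div_pow, one_pow]
    refine Summable.of_nonneg_of_le (fun k => by positivity) (fun k => ?_) (hu.2.add h1)
    nlinarith [sq_nonneg (‖taylorCoeff u k‖ - (1 / ((k : ℝ) + 1))),
      sq_nonneg (‖taylorCoeff u k‖), sq_nonneg ((1 / ((k : ℝ) + 1)))]
  have hgb : ∀ k z, ‖z‖ ≤ 1 → ‖g k z‖ ≤ ‖taylorCoeff u k‖ * (1 / ((k : ℝ) + 1)) := by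
    intro k z hz
    simp only [g, norm_mul, norm_div, norm_pow]
    have : ‖(k:ℂ) + 1‖ = (k:ℝ) + 1 := by
      have := Complex.norm_natCast (k + 1)
      push_cast at this
      exact this
    rw [this]
    gcongr
    exact pow_le_one₀ (norm_nonneg _) hz
  refine ⟨fun z => ∑' k, g k z, ?_, ?_⟩
  · refine continuousOn_tsum (fun k => ?_) hS (fun k z hz => hgb k z (by simpa using hz))
    simp only [g]
    fun_prop
  · intro z hz
    obtain ⟨ρ, hρ1, hρ2⟩ := exists_between hz
    have hρ0 : 0 ≤ ρ := (norm_nonneg z).trans hρ1.le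
    have := hasDerivAt_tsum_of_isPreconnected (g := g)
      (g' := fun k z => taylorCoeff u k * z ^ k) (y₀ := 0) (y := z)
      (summable_norm_tay hu.1 hρ0 hρ2) (t := Metric.ball 0 ρ) Metric.isOpen_ball
      (convex_ball _ _).isPreconnected ?_ ?_ ?_ ?_ (by simpa using hρ1)
    · rwa [(hasSum_tay hu.1 hz).tsum_eq] at this
    · intro k y _
      have hk : (k : ℂ) + 1 ≠ 0 := by exact_mod_cast Nat.succ_ne_zero k
      have h := ((hasDerivAt_pow (k + 1) y).div_const ((k:ℂ) + 1)).const_mul (taylorCoeff u k)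
      refine h.congr_deriv ?_
      push_cast
      field_simp
    · intro k y hy
      rw [norm_mul, norm_pow]
      have : ‖y‖ < ρ := by simpa using hy
      gcongr
    · simpa using lt_of_le_of_lt (norm_nonneg z) hρ1
    · simp [g]

lemma bv_prim {u U : ℂ → ℂ} (hu : MemH2 u) (hc : ContinuousOn U (Metric.closedBall 0 1))
    (hd : ∀ z, ‖z‖ < 1 → HasDerivAt U (u z) z) :
    BoundedVariationOn (fun t : ℝ => U (exp (t * I))) (Icc 0 (2 * Real.pi)) := by
  set C : ℝ := Real.pi * (1 + h2NormSq u)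
  have hV : ∀ r : ℝ, 0 < r → r < 1 →
      eVariationOn (fun t : ℝ => U (circleMap 0 r t)) (Icc 0 (2 * Real.pi)) ≤ ENNReal.ofReal C := by
    intro r h0 h1
    have hcu := circInt hu.1 h0.le h1
    have hmem : ∀ t, ‖circleMap 0 r t‖ < 1 := fun t => by simp [abs_of_pos h0, h1]
    have hder : ∀ t : ℝ, HasDerivAt (fun t : ℝ => U (circleMap 0 r t))
        (u (circleMap 0 r t) * (circleMap 0 r t * I)) t := by
      intro t
      have := (hd _ (hmem t)).scomp t (hasDerivAt_circleMap 0 r t)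
      refine this.congr_deriv ?_
      simp [mul_comm]
    refine iSup_le ?_
    rintro ⟨n, t, tm, ts⟩
    simp only
    have hb : ∀ i, edist (U (circleMap 0 r (t (i + 1)))) (U (circleMap 0 r (t i))) ≤
        ENNReal.ofReal (∫ x in (t i)..(t (i+1)), ‖u (circleMap 0 r x)‖) := by
      intro i
      rw [edist_dist, dist_eq_norm]
      apply ENNReal.ofReal_le_ofReal
      rw [← intervalIntegral.integral_eq_sub_of_hasDerivAt (fun x _ => hder x)]
      · refine intervalIntegral.norm_integral_le_of_norm_le (tm (Nat.le_succ i)) ?_ ?_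
        · refine Eventually.of_forall fun x _ => ?_
          rw [norm_mul]
          refine mul_le_of_le_one_right (norm_nonneg _) ?_
          rw [norm_mul, norm_I, mul_one]
          exact (hmem x).le
        · exact hcu.norm.intervalIntegrable _ _
      · apply Continuous.intervalIntegrable
        exact hcu.mul ((continuous_circleMap 0 r).mul continuous_const)
    calc _ ≤ ∑ i ∈ Finset.range n, ENNReal.ofReal (∫ x in (t i)..(t (i+1)), ‖u (circleMap 0 r x)‖) :=
          Finset.sum_le_sum fun i _ => hb i
      _ = ENNReal.ofReal (∑ i ∈ Finset.range n, ∫ x in (t i)..(t (i+1)), ‖u (circleMap 0 r x)‖) := by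
          rw [ENNReal.ofReal_sum_of_nonneg]
          intro i _
          exact intervalIntegral.integral_nonneg (tm (Nat.le_succ i)) fun x _ => norm_nonneg _
      _ = ENNReal.ofReal (∫ x in (t 0)..(t n), ‖u (circleMap 0 r x)‖) := by
          rw [intervalIntegral.sum_integral_adjacent_intervals]
          intro k _
          exact hcu.norm.intervalIntegrable _ _
      _ ≤ ENNReal.ofReal C := by
          apply ENNReal.ofReal_le_ofReal
          have h2 : ∫ x in (t 0)..(t n), ‖u (circleMap 0 r x)‖ ≤
              ∫ x in (0:ℝ)..(2 * Real.pi), ‖u (circleMap 0 r x)‖ := by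
            refine intervalIntegral.integral_mono_interval (ts 0).1 (tm (Nat.zero_le n)) (ts n).2 ?_ ?_
            · exact Eventually.of_forall fun x => norm_nonneg _
            · exact hcu.norm.intervalIntegrable _ _
          refine h2.trans ?_
          have h3 : ∫ x in (0:ℝ)..(2 * Real.pi), ‖u (circleMap 0 r x)‖ ≤
              ∫ x in (0:ℝ)..(2 * Real.pi), (1 / 2 + 1 / 2 * ‖u (circleMap 0 r x)‖ ^ 2) := by
            refine intervalIntegral.integral_mono_on (by positivity) (hcu.norm.intervalIntegrable _ _) ?_ ?_
            · apply Continuous.intervalIntegrable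
              exact continuous_const.add (continuous_const.mul (hcu.norm.pow 2))
            · intro x _
              nlinarith [sq_nonneg (‖u (circleMap 0 r x)‖ - 1)]
          refine h3.trans ?_
          have hi2 : IntervalIntegrable (fun x => 1 / 2 * ‖u (circleMap 0 r x)‖ ^ 2) volume 0
              (2 * Real.pi) := (continuous_const.mul (hcu.norm.pow 2)).intervalIntegrable _ _
          rw [intervalIntegral.integral_add intervalIntegrable_const hi2,
            intervalIntegral.integral_const, intervalIntegral.integral_const_mul]
          have h4 := avg_le hu h0.le h1
          rw [avg, Real.circleAverage, smul_eq_mul, inv_mul_le_iff₀ (by positivity)] at h4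
          simp only [C, smul_eq_mul]
          linarith
  have hlim : ∀ t ∈ Icc (0:ℝ) (2 * Real.pi), Tendsto (fun r : ℝ => U (circleMap 0 r t))
      (nhdsWithin 1 (Iio 1)) (nhds (U (exp (t * I)))) := by
    intro t _
    have h1 : ContinuousWithinAt U (Metric.closedBall 0 1) (exp (t * I)) := hc _ (by simp)
    refine h1.tendsto.comp ?_
    rw [tendsto_nhdsWithin_iff]
    constructor
    · have : Continuous (fun r : ℝ => circleMap 0 r t) := by
        simp only [circleMap_zero]
        fun_prop
      have h := this.tendsto 1
      simp only [circleMap_zero, ofReal_one, one_mul] at h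
      simp only [circleMap_zero]
      exact h.mono_left nhdsWithin_le_nhds
    · have h3 : ∀ᶠ r : ℝ in nhdsWithin 1 (Iio 1), 0 < r ∧ r < 1 :=
        Filter.Eventually.and (nhdsWithin_le_nhds (lt_mem_nhds (by norm_num)))
          self_mem_nhdsWithin
      filter_upwards [h3] with r hr
      simp [abs_of_pos hr.1, hr.2.le]
  have hle : eVariationOn (fun t : ℝ => U (exp (t * I))) (Icc 0 (2 * Real.pi)) ≤
      ENNReal.ofReal C := by
    by_contra hcon
    push Not at hcon
    have h := eVariationOn.lowerSemicontinuous_aux hlim hcon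
    have h3 : ∀ᶠ r : ℝ in nhdsWithin 1 (Iio 1), 0 < r ∧ r < 1 :=
        Filter.Eventually.and (nhdsWithin_le_nhds (lt_mem_nhds (by norm_num)))
          self_mem_nhdsWithin
    obtain ⟨r, hr, hr2⟩ := (h.and h3).exists
    exact absurd (hV r hr2.1 hr2.2) (not_le.2 hr)
  exact ne_top_of_le_ne_top ENNReal.ofReal_ne_top hle

/-- Fatou's theorem for `H²`. -/
lemma fatou_H2 {u : ℂ → ℂ} (hu : MemH2 u) :
    ∀ᵐ (θ : ℝ) ∂(volume.restrict (Set.Ioc (0:ℝ) (2 * Real.pi))),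
      Tendsto (fun r : ℝ => u ((r : ℂ) * exp (θ * I))) (nhdsWithin 1 (Iio 1))
        (nhds (bdryVal u (exp (θ * I)))) := by
  obtain ⟨U, hc, hd⟩ := exists_prim hu
  have hbv := bv_prim hu hc hd
  have hpi := Real.pi_pos
  rw [← uIcc_of_le (by positivity : (0:ℝ) ≤ 2 * Real.pi)] at hbv
  rw [ae_restrict_iff' measurableSet_Ioc]
  filter_upwards [hbv.ae_differentiableAt_of_mem_uIcc] with θ hθ hmem
  have hdf := hθ (by rw [uIcc_of_le (by positivity)]; exact Ioc_subset_Icc_self hmem)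
  unfold bdryVal
  apply tendsto_nhds_limUnder
  set ζ := exp (θ * I) with hζ
  have hζn : ‖ζ‖ = 1 := norm_exp_ofReal_mul_I θ
  have hζ0 : ζ ≠ 0 := exp_ne_zero _
  set D := deriv (fun t : ℝ => U (exp (t * I))) θ with hD
  have hD' : HasDerivAt (fun t : ℝ => U (exp (t * I))) D θ := hdf.hasDerivAt
  set A := D / (I * ζ) with hA
  refine ⟨A, ?_⟩
  let W : ℂ → ℂ := fun z => U (ζ * z) - U ζ - A * (ζ * z - ζ)
  have hWd : ∀ z, ‖z‖ < 1 → HasDerivAt W (ζ * (u (ζ * z) - A)) z := by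
    intro z hz
    have h1 : HasDerivAt (fun z : ℂ => ζ * z) ζ z := by
      simpa using (hasDerivAt_id z).const_mul ζ
    have h2 := (hd (ζ * z) (by simpa [hζn] using hz)).comp z h1
    have h3 := (h2.sub_const (U ζ)).sub ((h1.sub_const ζ).const_mul A)
    refine h3.congr_deriv ?_
    ring
  have hW := deriv_tendsto_zero (W := W) ?_ ?_ ?_ ?_
  · have h4 : Tendsto (fun r : ℝ => ζ⁻¹ * deriv W r + A) (nhdsWithin 1 (Iio 1)) (nhds A) := by
      have := (hW.const_mul ζ⁻¹).add_const A
      simpa using this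
    refine h4.congr' ?_
    have h3 : ∀ᶠ r : ℝ in nhdsWithin 1 (Iio 1), 0 < r ∧ r < 1 :=
        Filter.Eventually.and (nhdsWithin_le_nhds (lt_mem_nhds (by norm_num)))
          self_mem_nhdsWithin
    filter_upwards [h3] with r hr
    rw [(hWd r (by simpa [abs_of_pos hr.1] using hr.2)).deriv]
    rw [mul_comm (r:ℂ) ζ]
    field_simp
    ring
  · refine ContinuousOn.sub (ContinuousOn.sub ?_ continuousOn_const) (by fun_prop)
    refine hc.comp (by fun_prop) ?_
    intro z hz
    simpa [hζn] using hz
  · intro z hz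
    exact (hWd z (by simpa [unitDisk] using hz)).differentiableAt.differentiableWithinAt
  · simp [W]
  · have e : (fun t : ℝ => W (exp (t * I))) =
        fun t : ℝ => U (exp (((θ + t : ℝ) : ℂ) * I)) - U ζ - A * (exp (((θ + t : ℝ) : ℂ) * I) - ζ) := by
      funext t
      have : ζ * exp (t * I) = exp (((θ + t : ℝ) : ℂ) * I) := by
        rw [hζ, ← exp_add]
        push_cast
        ring_nf
      simp only [W, this]
    rw [e]
    have hs : HasDerivAt (fun t : ℝ => θ + t) 1 0 := by
      simpa using (hasDerivAt_id (0:ℝ)).const_add θ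
    have h5 : HasDerivAt (fun t : ℝ => U (exp (((θ + t : ℝ) : ℂ) * I))) D 0 := by
      have h6 : HasDerivAt (fun t : ℝ => U (exp (t * I))) D (θ + 0) := by simpa using hD'
      have := h6.scomp (0:ℝ) hs
      simpa [Function.comp_def] using this
    have h7 : HasDerivAt (fun t : ℝ => exp (((θ + t : ℝ) : ℂ) * I)) (I * ζ) 0 := by
      have h6 : HasDerivAt (fun t : ℝ => exp (t * I)) (I * ζ) (θ + 0) := by
        have := hasDerivAt_circleMap 0 1 (θ + 0)
        have e : circleMap 0 1 = fun t : ℝ => exp (t * I) := by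
          funext t
          simp [circleMap]
        rw [e] at this
        refine HasDerivAt.congr_deriv this ?_
        simp [hζ, mul_comm]
      have := h6.scomp (0:ℝ) hs
      simpa [Function.comp_def] using this
    have h8 := (h5.sub_const (U ζ)).sub ((h7.sub_const ζ).const_mul A)
    refine h8.congr_deriv ?_
    rw [hA]
    field_simp
    simp

lemma circ_sub_ne {w : ℂ} (hw : ‖w‖ < 1) (θ : ℝ) : circleMap 0 1 θ - w ≠ 0 := by
  intro h
  have : ‖circleMap 0 1 θ‖ = ‖w‖ := by rw [sub_eq_zero.1 h]
  simp at this
  linarith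

lemma herg_nonneg {w : ℂ} (hw : ‖w‖ < 1) (θ : ℝ) :
    0 ≤ ((circleMap 0 1 θ + w) / (circleMap 0 1 θ - w)).re := by
  have := le_re_herglotzRieszKernel (c := 0) (R := 1) (z := circleMap 0 1 θ) (w := w)
    (by simp) (by simpa using hw)
  simp only [sub_zero] at this
  refine le_trans ?_ this
  apply div_nonneg <;> linarith [norm_nonneg w]

lemma herg_le {w : ℂ} (hw : ‖w‖ < 1) (θ : ℝ) :
    ((circleMap 0 1 θ + w) / (circleMap 0 1 θ - w)).re ≤ (1 + ‖w‖) / (1 - ‖w‖) := by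
  have := re_herglotzRieszKernel_le (c := 0) (R := 1) (z := circleMap 0 1 θ) (w := w)
    (by simp) (by simpa using hw)
  simpa only [sub_zero] using this

lemma poisson_sq (g : Polynomial ℂ) {w : ℂ} (hw : ‖w‖ < 1) :
    2 * Real.pi * ‖g.eval w‖ ^ 2 ≤ ∫ θ in (0:ℝ)..(2 * Real.pi),
      ((circleMap 0 1 θ + w) / (circleMap 0 1 θ - w)).re * ‖g.eval (circleMap 0 1 θ)‖ ^ 2 := by
  have h := DiffContOnCl.circleAverage_re_herglotzRieszKernel_smul' (c := 0) (R := 1)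
    (f := fun z => (g.eval z) ^ 2) (w := w)
    (Differentiable.diffContOnCl (by fun_prop)) (by simpa using hw)
  simp only [sub_zero] at h
  rw [Real.circleAverage] at h
  have h2 := congrArg norm h
  rw [norm_smul, norm_pow, Real.norm_of_nonneg (by positivity)] at h2
  have h3 := intervalIntegral.norm_integral_le_integral_norm (a := 0) (b := 2 * Real.pi)
    (f := fun θ => ((circleMap 0 1 θ + w) / (circleMap 0 1 θ - w)).re •
      (g.eval (circleMap 0 1 θ)) ^ 2) (μ := volume) (by positivity)
  rw [← h2]
  have hp := Real.pi_pos
  calc _ = ‖∫ θ in (0:ℝ)..(2 * Real.pi), ((circleMap 0 1 θ + w) / (circleMap 0 1 θ - w)).re •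
      (g.eval (circleMap 0 1 θ)) ^ 2‖ := by field_simp
    _ ≤ _ := h3
    _ = _ := by
      congr 1
      funext θ
      rw [norm_smul, norm_pow, Real.norm_of_nonneg (herg_nonneg hw θ)]

lemma mean_herg {φ : ℂ → ℂ} (hφ : DifferentiableOn ℂ φ unitDisk)
    (hm : ∀ z ∈ unitDisk, φ z ∈ unitDisk) {r : ℝ} (h0 : 0 < r) (h1 : r < 1) (θ : ℝ) :
    ∫ t in (0:ℝ)..(2 * Real.pi), ((circleMap 0 1 θ + φ (circleMap 0 r t)) /
      (circleMap 0 1 θ - φ (circleMap 0 r t))).re =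
    2 * Real.pi * ((circleMap 0 1 θ + φ 0) / (circleMap 0 1 θ - φ 0)).re := by
  set F : ℂ → ℂ := fun z => (circleMap 0 1 θ + φ z) / (circleMap 0 1 θ - φ z) with hF
  have hd : DifferentiableOn ℂ F unitDisk := by
    refine DifferentiableOn.div (hφ.const_add _) (hφ.const_sub _) ?_
    intro z hz
    exact circ_sub_ne (mem_uD.1 (hm z hz)) θ
  have hA := DiffContOnCl.circleAverage (f := F) (c := 0) (R := r) (by
    refine DifferentiableOn.diffContOnCl (hd.mono ?_)
    refine Metric.closure_ball_subset_closedBall.trans ?_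
    intro z hz
    rw [mem_uD]
    have : ‖z‖ ≤ r := by simpa [abs_of_pos h0] using hz
    linarith)
  rw [Real.circleAverage] at hA
  have h2 := congrArg Complex.reCLM hA
  rw [map_smul, ← ContinuousLinearMap.intervalIntegral_comp_comm _
    ((circInt hd h0.le h1).intervalIntegrable _ _)] at h2
  have hp := Real.pi_pos
  simp only [reCLM_apply, smul_eq_mul] at h2
  change ∫ t in (0:ℝ)..(2 * Real.pi), (F (circleMap 0 r t)).re = _ * (F 0).re
  rw [← h2]
  field_simp

lemma swap_cont {K : ℝ → ℝ → ℝ} (hK : Continuous (Function.uncurry K)) (a b c d : ℝ) :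
    ∫ x in a..b, ∫ y in c..d, K x y = ∫ y in c..d, ∫ x in a..b, K x y := by
  apply intervalIntegral_intervalIntegral_swap
  refine IntegrableOn.mono_set (t := uIcc a b ×ˢ uIcc c d) ?_
    (prod_mono uIoc_subset_uIcc uIoc_subset_uIcc)
  exact hK.continuousOn.integrableOn_compact (isCompact_uIcc.prod isCompact_uIcc)

/-- Littlewood subordination for polynomials. -/
lemma littlewood {φ : ℂ → ℂ} (hφ : DifferentiableOn ℂ φ unitDisk)
    (hm : ∀ z ∈ unitDisk, φ z ∈ unitDisk) (g : Polynomial ℂ) {r : ℝ} (h0 : 0 < r) (h1 : r < 1) :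
    avg (fun z => g.eval (φ z)) r ≤
      (1 + ‖φ 0‖) / (1 - ‖φ 0‖) * ∑ i ∈ g.support, ‖g.coeff i‖ ^ 2 := by
  have hp := Real.pi_pos
  have hφ0 : ‖φ 0‖ < 1 := mem_uD.1 (hm 0 (by simp [mem_uD]))
  have hφt : ∀ t, ‖φ (circleMap 0 r t)‖ < 1 := fun t => mem_uD.1 (hm _ (by
    simp [mem_uD, abs_of_pos h0, h1]))
  have hcφ := circInt hφ h0.le h1
  obtain ⟨K, hKd⟩ : ∃ K : ℝ → ℝ → ℝ, K = fun t θ => ((circleMap 0 1 θ + φ (circleMap 0 r t)) /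
      (circleMap 0 1 θ - φ (circleMap 0 r t))).re * ‖g.eval (circleMap 0 1 θ)‖ ^ 2 := ⟨_, rfl⟩
  have hK : Continuous (Function.uncurry K) := by
    simp only [hKd, Function.uncurry_def]
    have e1 : Continuous (fun p : ℝ × ℝ => φ (circleMap 0 r p.1)) := hcφ.comp continuous_fst
    have e2 : Continuous (fun p : ℝ × ℝ => circleMap 0 1 p.2) :=
      (continuous_circleMap 0 1).comp continuous_snd
    refine (Complex.continuous_re.comp ((e2.add e1).div (e2.sub e1) fun p => circ_sub_ne (hφt _) _)).mul
      ((g.continuous.comp e2).norm.pow 2)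
  rw [Polynomial.sum_sq_norm_coeff_eq_circleAverage, avg, Real.circleAverage, Real.circleAverage,
    smul_eq_mul, smul_eq_mul]
  have s1 : 2 * Real.pi * ∫ t in (0:ℝ)..(2 * Real.pi), ‖g.eval (φ (circleMap 0 r t))‖ ^ 2 ≤
      ∫ t in (0:ℝ)..(2 * Real.pi), ∫ θ in (0:ℝ)..(2 * Real.pi), K t θ := by
    rw [← intervalIntegral.integral_const_mul]
    refine intervalIntegral.integral_mono_on (by positivity) ?_ ?_ fun t _ => by
      rw [hKd]
      exact poisson_sq g (hφt t)
    · exact (continuous_const.mul ((g.continuous.comp hcφ).norm.pow 2)).intervalIntegrable _ _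
    · exact (intervalIntegral.continuous_parametric_intervalIntegral_of_continuous' hK _ _).intervalIntegrable _ _
  rw [swap_cont hK] at s1
  · have s2 : ∫ θ in (0:ℝ)..(2 * Real.pi), ∫ t in (0:ℝ)..(2 * Real.pi), K t θ ≤
        ∫ θ in (0:ℝ)..(2 * Real.pi), 2 * Real.pi * ((1 + ‖φ 0‖) / (1 - ‖φ 0‖)) *
          ‖g.eval (circleMap 0 1 θ)‖ ^ 2 := by
      refine intervalIntegral.integral_mono_on (by positivity) ?_ ?_ fun θ _ => ?_
      · refine (intervalIntegral.continuous_parametric_intervalIntegral_of_continuous'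
          (f := fun θ t => K t θ) ?_ _ _).intervalIntegrable _ _
        exact hK.comp continuous_swap
      · exact (continuous_const.mul ((g.continuous.comp (continuous_circleMap 0 1)).norm.pow 2)).intervalIntegrable _ _
      · simp only [hKd]
        rw [intervalIntegral.integral_mul_const, mean_herg hφ hm h0 h1]
        gcongr
        exact herg_le hφ0 θ
    rw [intervalIntegral.integral_const_mul] at s2
    have s3 := s1.trans s2
    have : 0 < 2 * Real.pi := by positivity
    have s4 : ∫ t in (0:ℝ)..(2 * Real.pi), ‖g.eval (φ (circleMap 0 r t))‖ ^ 2 ≤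
      ((1 + ‖φ 0‖) / (1 - ‖φ 0‖)) *
         ∫ θ in (0:ℝ)..(2 * Real.pi), ‖g.eval (circleMap 0 1 θ)‖ ^ 2 := by
      exact le_of_mul_le_mul_left (by linarith [s3]) this
    rw [mul_left_comm]
    gcongr

lemma tay_unique {f : ℂ → ℂ} (hf : DifferentiableOn ℂ f unitDisk) {c : ℕ → ℂ}
    (h : ∀ z, ‖z‖ < 1 → HasSum (fun k => c k * z ^ k) (f z)) (k : ℕ) : taylorCoeff f k = c k := by
  have key : ∀ c : ℕ → ℂ, (∀ z, ‖z‖ < 1 → HasSum (fun k => c k * z ^ k) (f z)) →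
      HasFPowerSeriesAt f (FormalMultilinearSeries.ofScalars ℂ c) 0 := by
    intro c hc
    rw [hasFPowerSeriesAt_iff]
    filter_upwards [Metric.ball_mem_nhds (0:ℂ) one_pos] with z hz
    have := hc z (by simpa using hz)
    simpa [FormalMultilinearSeries.coeff_ofScalars, mul_comm] using this
  have e := (key _ (fun z hz => hasSum_tay hf hz)).eq_formalMultilinearSeries (key _ h)
  have := congrArg (fun p => FormalMultilinearSeries.coeff p k) e
  simpa [FormalMultilinearSeries.coeff_ofScalars] using this

lemma tay_congr {f g : ℂ → ℂ} (hf : DifferentiableOn ℂ f unitDisk)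
    (hg : DifferentiableOn ℂ g unitDisk)
    (h : ∀ z ∈ unitDisk, f z = g z) (k : ℕ) : taylorCoeff f k = taylorCoeff g k := by
  refine tay_unique hf (fun z hz => ?_) k
  rw [h z (mem_uD.2 hz)]
  exact hasSum_tay hg hz

lemma h2_congr {f g : ℂ → ℂ} (hf : DifferentiableOn ℂ f unitDisk)
    (hg : DifferentiableOn ℂ g unitDisk)
    (h : ∀ z ∈ unitDisk, f z = g z) : h2NormSq f = h2NormSq g := by
  simp only [h2NormSq, tay_congr hf hg h]

lemma tay_poly (g : Polynomial ℂ) (k : ℕ) : taylorCoeff (fun z => g.eval z) k = g.coeff k := by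
  refine tay_unique (by fun_prop) (fun z _ => ?_) k
  rw [Polynomial.eval_eq_sum, Polynomial.sum]
  refine hasSum_sum_of_ne_finset_zero fun b hb => ?_
  simp [Polynomial.notMem_support_iff.1 hb]

lemma h2_poly (g : Polynomial ℂ) : MemH2 (fun z => g.eval z) ∧
    h2NormSq (fun z => g.eval z) = ∑ i ∈ g.support, ‖g.coeff i‖ ^ 2 := by
  have : HasSum (fun k => ‖taylorCoeff (fun z => g.eval z) k‖ ^ 2)
      (∑ i ∈ g.support, ‖g.coeff i‖ ^ 2) := by
    simp only [tay_poly]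
    refine hasSum_sum_of_ne_finset_zero fun b hb => ?_
    simp [Polynomial.notMem_support_iff.1 hb]
  exact ⟨⟨by fun_prop, this.summable⟩, this.tsum_eq⟩

lemma dil_sub {h : ℂ → ℂ} (hh : MemH2 h) {t : ℝ} (h0 : 0 ≤ t) (h1 : t ≤ 1) :
    MemH2 (fun z => h (t * z) - h z) ∧ h2NormSq (fun z => h (t * z) - h z) =
      ∑' k, ‖taylorCoeff h k‖ ^ 2 * (1 - t ^ k) ^ 2 := by
  have hmap : ∀ z : ℂ, ‖z‖ < 1 → ‖(t:ℂ) * z‖ < 1 := by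
    intro z hz
    rw [norm_mul, norm_real, Real.norm_of_nonneg h0]
    exact lt_of_le_of_lt (mul_le_of_le_one_left (norm_nonneg _) h1) hz
  have hd : DifferentiableOn ℂ (fun z => h (t * z) - h z) unitDisk := by
    refine DifferentiableOn.sub (hh.1.comp (by fun_prop) ?_) hh.1
    intro z hz
    exact mem_uD.2 (hmap z (mem_uD.1 hz))
  have hc : ∀ k, taylorCoeff (fun z => h (t * z) - h z) k = taylorCoeff h k * ((t ^ k - 1 : ℝ) : ℂ) := by
    refine tay_unique hd fun z hz => ?_
    refine ((hasSum_tay hh.1 (hmap z hz)).sub (hasSum_tay hh.1 hz)).congr_fun ?_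
    intro k
    push_cast
    ring
  have hn : ∀ k, ‖taylorCoeff (fun z => h (t * z) - h z) k‖ ^ 2 =
      ‖taylorCoeff h k‖ ^ 2 * (1 - t ^ k) ^ 2 := by
    intro k
    rw [hc, norm_mul, norm_real, mul_pow, Real.norm_eq_abs, sq_abs]
    ring
  refine ⟨⟨hd, ?_⟩, ?_⟩
  · simp only [hn]
    refine Summable.of_nonneg_of_le (fun k => by positivity) (fun k => ?_) hh.2
    refine mul_le_of_le_one_right (by positivity) ?_
    have a1 : t ^ k ≤ 1 := pow_le_one₀ h0 h1
    have a2 : 0 ≤ t ^ k := by positivity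
    nlinarith
  · simp only [h2NormSq, hn]

lemma eps_tendsto {h : ℂ → ℂ} (hh : MemH2 h) :
    Tendsto (fun t : ℝ => ∑' k, ‖taylorCoeff h k‖ ^ 2 * (1 - t ^ k) ^ 2)
      (nhdsWithin 1 (Iio 1)) (nhds 0) := by
  have e : (0:ℝ) = ∑' k : ℕ, (0:ℝ) := by simp
  rw [e]
  refine tendsto_tsum_of_dominated_convergence (bound := fun k => ‖taylorCoeff h k‖ ^ 2) hh.2 ?_ ?_
  · intro k
    have : Continuous (fun t : ℝ => ‖taylorCoeff h k‖ ^ 2 * (1 - t ^ k) ^ 2) := by fun_prop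
    have h2 := this.tendsto 1
    simp only [one_pow, sub_self, ne_eq, OfNat.ofNat_ne_zero, not_false_eq_true, zero_pow,
      mul_zero] at h2
    exact h2.mono_left nhdsWithin_le_nhds
  · have h3 : ∀ᶠ r : ℝ in nhdsWithin 1 (Iio 1), 0 < r ∧ r < 1 :=
        Filter.Eventually.and (nhdsWithin_le_nhds (lt_mem_nhds (by norm_num)))
          self_mem_nhdsWithin
    filter_upwards [h3] with t ht k
    rw [Real.norm_of_nonneg (by positivity)]
    refine mul_le_of_le_one_right (by positivity) ?_
    have a1 : t ^ k ≤ 1 := pow_le_one₀ ht.1.le ht.2.le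
    have a2 : 0 ≤ t ^ k := pow_nonneg ht.1.le k
    nlinarith

lemma fatou_bound {F : ℕ → ℝ → ℝ} {f : ℝ → ℝ} {B : ℝ} (hF : ∀ j, Continuous (F j))
    (hF0 : ∀ j θ, 0 ≤ F j θ) (hf : Continuous f) (hf0 : ∀ θ, 0 ≤ f θ)
    (hlim : ∀ᵐ θ ∂(volume.restrict (Set.Ioc (0:ℝ) (2 * Real.pi))),
      ∃ L, Tendsto (fun j => F j θ) atTop (nhds L) ∧ f θ ≤ L)
    (hB : ∀ j, ∫ θ in (0:ℝ)..(2 * Real.pi), F j θ ≤ B) (hB0 : 0 ≤ B) :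
    ∫ θ in (0:ℝ)..(2 * Real.pi), f θ ≤ B := by
  have hp : (0:ℝ) ≤ 2 * Real.pi := by positivity
  have conv : ∀ G : ℝ → ℝ, Continuous G → (∀ θ, 0 ≤ G θ) →
      ENNReal.ofReal (∫ θ in (0:ℝ)..(2 * Real.pi), G θ) =
        ∫⁻ θ in Set.Ioc (0:ℝ) (2 * Real.pi), ENNReal.ofReal (G θ) := by
    intro G hG hG0
    rw [intervalIntegral.integral_of_le hp]
    refine ofReal_integral_eq_lintegral_ofReal ?_ (Eventually.of_forall hG0)
    exact (hG.intervalIntegrable 0 (2 * Real.pi)).1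
  rw [← ENNReal.ofReal_le_ofReal_iff hB0, conv f hf hf0]
  calc _ ≤ ∫⁻ θ in Set.Ioc (0:ℝ) (2 * Real.pi), liminf (fun j => ENNReal.ofReal (F j θ)) atTop := by
        refine lintegral_mono_ae ?_
        filter_upwards [hlim] with θ ⟨L, hL, hle⟩
        have := (ENNReal.continuous_ofReal.tendsto L).comp hL
        have e := this.liminf_eq
        simp only [Function.comp_def] at e
        rw [e]
        exact ENNReal.ofReal_le_ofReal hle
    _ ≤ liminf (fun j => ∫⁻ θ in Set.Ioc (0:ℝ) (2 * Real.pi), ENNReal.ofReal (F j θ)) atTop :=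
        lintegral_liminf_le fun j => (hF j).measurable.ennreal_ofReal
    _ ≤ ENNReal.ofReal B := by
        refine liminf_le_of_le (by isBoundedDefault) fun b hb => ?_
        obtain ⟨j, hj⟩ := hb.exists
        refine hj.trans ?_
        rw [← conv _ (hF j) (hF0 j)]
        exact ENNReal.ofReal_le_ofReal (hB j)

lemma avg_mono {f : ℂ → ℂ} (hf : DifferentiableOn ℂ f unitDisk) {r t : ℝ} (h0 : 0 ≤ r) (h1 : r ≤ t)
    (h2 : t < 1) : avg f r ≤ avg f t := by
  refine hasSum_le (fun k => ?_) (parseval hf h0 (h1.trans_lt h2)) (parseval hf (h0.trans h1) h2)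
  gcongr

def rs (j : ℕ) : ℝ := 1 - 1 / ((j : ℝ) + 2)

lemma rs_pos (j : ℕ) : 0 < rs j := by
  have : (1:ℝ) / ((j : ℝ) + 2) < 1 := by
    rw [div_lt_one (by positivity)]
    linarith [(Nat.cast_nonneg j : (0:ℝ) ≤ j)]
  simp only [rs]
  linarith

lemma rs_lt (j : ℕ) : rs j < 1 := by
  have : (0:ℝ) < 1 / ((j : ℝ) + 2) := by positivity
  simp only [rs]
  linarith

lemma rs_tendsto : Tendsto rs atTop (nhdsWithin 1 (Iio 1)) := by
  rw [tendsto_nhdsWithin_iff]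
  refine ⟨?_, Eventually.of_forall rs_lt⟩
  have h := (tendsto_add_atTop_iff_nat (f := fun n : ℕ => 1 / (n : ℝ)) 2).2
    tendsto_one_div_atTop_nhds_zero_nat
  have := h.const_sub 1
  simp only [sub_zero] at this
  refine this.congr fun j => ?_
  simp [rs]

lemma int_avg (f : ℂ → ℂ) (r : ℝ) :
    ∫ θ in (0:ℝ)..(2 * Real.pi), ‖f (circleMap 0 r θ)‖ ^ 2 = 2 * Real.pi * avg f r := by
  have := Real.pi_pos
  rw [avg, Real.circleAverage, smul_eq_mul]
  field_simp

lemma wcomp_step {u φ : ℂ → ℂ} (hu : MemH2 u) (hφH : MemH2 φ)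
    (hm : ∀ z ∈ unitDisk, φ z ∈ unitDisk) {δ M : ℝ} (hδ : 0 < δ)
    (hess : ∀ᵐ (θ : ℝ) ∂(volume.restrict (Set.Ioc (0:ℝ) (2 * Real.pi))),
        1 - δ ≤ ‖bdryVal φ (Complex.exp (θ * Complex.I))‖ →
          ‖bdryVal u (Complex.exp (θ * Complex.I))‖ ≤ M) (g : Polynomial ℂ)
    (hh : MemH2 (fun z => u z * g.eval (φ z))) {t : ℝ} (h0 : 0 < t) (h1 : t < 1) :
    avg (fun z => u z * g.eval (φ z)) t ≤
      2 * (M ^ 2 * ((1 + ‖φ 0‖) / (1 - ‖φ 0‖) * ∑ i ∈ g.support, ‖g.coeff i‖ ^ 2) +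
        (∑ i ∈ g.support, ‖g.coeff i‖ ^ 2) / δ * h2NormSq u) +
      2 * ∑' k, ‖taylorCoeff (fun z => u z * g.eval (φ z)) k‖ ^ 2 * (1 - t ^ k) ^ 2 := by
  have hp := Real.pi_pos
  have hφ0 : ‖φ 0‖ < 1 := mem_uD.1 (hm 0 (by simp [mem_uD]))
  obtain ⟨S, hS⟩ : ∃ S, S = ∑ i ∈ g.support, ‖g.coeff i‖ ^ 2 := ⟨_, rfl⟩
  have hS0 : 0 ≤ S := by rw [hS]; positivity
  obtain ⟨h, hhd⟩ : ∃ h : ℂ → ℂ, h = fun z => u z * g.eval (φ z) := ⟨_, rfl⟩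
  rw [← hhd] at hh ⊢
  rw [← hS]
  obtain ⟨H, hHd⟩ : ∃ H : ℂ → ℂ, H = fun z => h (t * z) - h z := ⟨_, rfl⟩
  obtain ⟨hHm, hHn⟩ := dil_sub hh h0.le h1.le
  rw [← hHd] at hHm hHn
  rw [← hHn]
  have hgd : DifferentiableOn ℂ (fun z => g.eval (φ z)) unitDisk :=
    g.differentiable.comp_differentiableOn hφH.1
  set B := 2 * (M ^ 2 * ((1 + ‖φ 0‖) / (1 - ‖φ 0‖) * S) + S / δ * h2NormSq u) + 2 * h2NormSq H
    with hB
  have hC0 : 0 ≤ (1 + ‖φ 0‖) / (1 - ‖φ 0‖) :=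
    div_nonneg (by linarith [norm_nonneg (φ 0)]) (by linarith)
  have hB0 : 0 ≤ B := by
    have := h2NormSq_nonneg u
    have := h2NormSq_nonneg H
    positivity
  have c1 : ∀ j, Continuous (fun θ => ‖g.eval (φ (circleMap 0 (rs j) θ))‖ ^ 2) :=
    fun j => (circInt hgd (rs_pos j).le (rs_lt j)).norm.pow 2
  have c2 : ∀ j, Continuous (fun θ => ‖u (circleMap 0 (rs j) θ)‖ ^ 2) :=
    fun j => (circInt hu.1 (rs_pos j).le (rs_lt j)).norm.pow 2
  have c3 : ∀ j, Continuous (fun θ => ‖H (circleMap 0 (rs j) θ)‖ ^ 2) :=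
    fun j => (circInt hHm.1 (rs_pos j).le (rs_lt j)).norm.pow 2
  have key := fatou_bound (F := fun j θ => 2 * (M ^ 2 * ‖g.eval (φ (circleMap 0 (rs j) θ))‖ ^ 2 +
      S / δ * ‖u (circleMap 0 (rs j) θ)‖ ^ 2) + 2 * ‖H (circleMap 0 (rs j) θ)‖ ^ 2)
    (f := fun θ => ‖h (circleMap 0 t θ)‖ ^ 2) (B := 2 * Real.pi * B) ?_ ?_ ?_ ?_ ?_ ?_ ?_
  · rw [int_avg] at key
    exact le_of_mul_le_mul_left key (by positivity)
  · intro j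
    exact (continuous_const.mul ((continuous_const.mul (c1 j)).add (continuous_const.mul (c2 j)))).add
      (continuous_const.mul (c3 j))
  · intro j θ
    positivity
  · exact (circInt hh.1 h0.le h1).norm.pow 2
  · intro θ
    positivity
  · filter_upwards [hess, fatou_H2 hu, fatou_H2 hφH] with θ he hu' hφ'
    set ζ := exp (θ * I) with hζ
    have hζn : ‖ζ‖ = 1 := norm_exp_ofReal_mul_I θ
    set us := bdryVal u ζ
    set ps := bdryVal φ ζ
    have t1 : Tendsto (fun j => u (circleMap 0 (rs j) θ)) atTop (nhds us) := by
      refine (hu'.comp rs_tendsto).congr fun j => ?_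
      simp [hζ, circleMap_zero]
    have t2 : Tendsto (fun j => φ (circleMap 0 (rs j) θ)) atTop (nhds ps) := by
      refine (hφ'.comp rs_tendsto).congr fun j => ?_
      simp [hζ, circleMap_zero]
    have t3 : Tendsto (fun j => g.eval (φ (circleMap 0 (rs j) θ))) atTop (nhds (g.eval ps)) :=
      (g.continuous.tendsto ps).comp t2
    have t4 : Tendsto (fun j => h (circleMap 0 (rs j) θ)) atTop (nhds (us * g.eval ps)) := by
      rw [hhd]
      exact t1.mul t3
    have htζ : ‖(t:ℂ) * ζ‖ < 1 := by simp [hζn, abs_of_pos h0, h1]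
    have t5 : Tendsto (fun j => h (t * circleMap 0 (rs j) θ)) atTop (nhds (h (t * ζ))) := by
      have hc : ContinuousAt h (t * ζ) :=
        (hh.1.differentiableAt (isOpen_uD.mem_nhds (mem_uD.2 htζ))).continuousAt
      refine hc.tendsto.comp ?_
      have h2 : Tendsto rs atTop (nhds 1) := rs_tendsto.mono_right nhdsWithin_le_nhds
      have h3 : Continuous (fun r : ℝ => (t:ℂ) * circleMap 0 r θ) := by
        simp only [circleMap_zero]
        fun_prop
      have h4 := (h3.tendsto 1).comp h2
      simpa [hζ, circleMap_zero, Function.comp_def] using h4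
    have t6 : Tendsto (fun j => H (circleMap 0 (rs j) θ)) atTop
        (nhds (h (t * ζ) - us * g.eval ps)) := by
      rw [hHd]
      exact t5.sub t4
    refine ⟨2 * (M ^ 2 * ‖g.eval ps‖ ^ 2 + S / δ * ‖us‖ ^ 2) + 2 * ‖h (t * ζ) - us * g.eval ps‖ ^ 2,
      ?_, ?_⟩
    · exact (((((t3.norm.pow 2).const_mul _).add ((t1.norm.pow 2).const_mul _)).const_mul _).add
        ((t6.norm.pow 2).const_mul _))
    · have e : circleMap 0 t θ = t * ζ := by simp [hζ, circleMap_zero]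
      rw [e]
      have k1 : ‖us * g.eval ps‖ ^ 2 ≤ M ^ 2 * ‖g.eval ps‖ ^ 2 + S / δ * ‖us‖ ^ 2 := by
        rw [norm_mul, mul_pow]
        by_cases hc : 1 - δ ≤ ‖ps‖
        · have := he hc
          have h2 : ‖us‖ ^ 2 ≤ M ^ 2 := by gcongr
          have h3 : 0 ≤ S / δ * ‖us‖ ^ 2 := by positivity
          have h4 : ‖us‖ ^ 2 * ‖g.eval ps‖ ^ 2 ≤ M ^ 2 * ‖g.eval ps‖ ^ 2 := by gcongr
          linarith
        · push Not at hc
          have hg := growth (h2_poly g).1 (z := ps) (by linarith)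
          rw [(h2_poly g).2, ← hS] at hg
          have h2 : ‖g.eval ps‖ ^ 2 ≤ S / δ := by
            rw [le_div_iff₀ hδ]
            refine le_trans ?_ hg
            gcongr
            linarith
          have h3 : 0 ≤ M ^ 2 * ‖g.eval ps‖ ^ 2 := by positivity
          have h4 : ‖us‖ ^ 2 * ‖g.eval ps‖ ^ 2 ≤ ‖us‖ ^ 2 * (S / δ) := by gcongr
          linarith
      have k2 : ‖h (t * ζ)‖ ≤ ‖us * g.eval ps‖ + ‖h (t * ζ) - us * g.eval ps‖ := by
        have := norm_add_le (us * g.eval ps) (h (t * ζ) - us * g.eval ps)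
        simpa using this
      have k3 : ‖h (t * ζ)‖ ^ 2 ≤ (‖us * g.eval ps‖ + ‖h (t * ζ) - us * g.eval ps‖) ^ 2 := by gcongr
      nlinarith [sq_nonneg (‖us * g.eval ps‖ - ‖h (t * ζ) - us * g.eval ps‖)]
  · intro j
    have i1 := (c1 j).intervalIntegrable (μ := volume) 0 (2 * Real.pi)
    have i2 := (c2 j).intervalIntegrable (μ := volume) 0 (2 * Real.pi)
    have i3 := (c3 j).intervalIntegrable (μ := volume) 0 (2 * Real.pi)
    rw [intervalIntegral.integral_add (((i1.const_mul _).add (i2.const_mul _)).const_mul _)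
      (i3.const_mul _), intervalIntegral.integral_const_mul, intervalIntegral.integral_const_mul,
      intervalIntegral.integral_add (i1.const_mul _) (i2.const_mul _),
      intervalIntegral.integral_const_mul, intervalIntegral.integral_const_mul, int_avg u, int_avg H,
      int_avg (fun z => g.eval (φ z))]
    have l1 := littlewood hφH.1 hm g (rs_pos j) (rs_lt j)
    rw [← hS] at l1
    have l2 := avg_le hu (rs_pos j).le (rs_lt j)
    have l3 := avg_le hHm (rs_pos j).le (rs_lt j)
    calc _ = 2 * Real.pi * (2 * (M ^ 2 * avg (fun z => g.eval (φ z)) (rs j) + S / δ * avg u (rs j))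
          + 2 * avg H (rs j)) := by ring
      _ ≤ _ := by
        rw [hB]
        gcongr
  · positivity

lemma mul_poly_mem {u φ : ℂ → ℂ} (hu : MemH2 u) (hφ : DifferentiableOn ℂ φ unitDisk)
    (hm : ∀ z ∈ unitDisk, φ z ∈ unitDisk) (g : Polynomial ℂ) :
    MemH2 (fun z => u z * g.eval (φ z)) := by
  obtain ⟨K, hK⟩ := (isCompact_closedBall (0:ℂ) 1).exists_bound_of_continuousOn
    (f := fun z => g.eval z) (by fun_prop)
  refine (memH2_of_le (hu.1.mul (g.differentiable.comp_differentiableOn hφ)) hu (ρ := 0)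
    (A := K ^ 2) (B := 0) one_pos (by positivity) fun z _ hz => ?_).1
  have h1 := hK (φ z) (by simpa using (mem_uD.1 (hm z (mem_uD.2 hz))).le)
  have h2 : ‖g.eval (φ z)‖ ^ 2 ≤ K ^ 2 := by gcongr
  simp only [Pi.mul_apply, Function.comp_apply]
  rw [norm_mul, mul_pow, add_zero, mul_comm]
  gcongr

lemma wcomp_bdd {u φ : ℂ → ℂ} (hu : MemH2 u) (hφ : DifferentiableOn ℂ φ unitDisk)
    (hm : ∀ z ∈ unitDisk, φ z ∈ unitDisk) {δ M : ℝ} (hδ : 0 < δ)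
    (hess : ∀ᵐ (θ : ℝ) ∂(volume.restrict (Set.Ioc (0:ℝ) (2 * Real.pi))),
        1 - δ ≤ ‖bdryVal φ (Complex.exp (θ * Complex.I))‖ →
          ‖bdryVal u (Complex.exp (θ * Complex.I))‖ ≤ M) :
    ∃ C : ℝ, 0 ≤ C ∧ ∀ g, MemH2 g → MemH2 (fun z => u z * g (φ z)) ∧
      h2NormSq (fun z => u z * g (φ z)) ≤ C * h2NormSq g := by
  have hφH : MemH2 φ := by
    have := h2_poly (0 : Polynomial ℂ)
    refine (memH2_of_le hφ this.1 (ρ := 0) (A := 0) (B := 1) one_pos le_rfl fun z _ hz => ?_).1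
    have := (mem_uD.1 (hm z (mem_uD.2 hz))).le
    simpa using this
  have hφ0 : ‖φ 0‖ < 1 := mem_uD.1 (hm 0 (by simp [mem_uD]))
  have hC0 : 0 ≤ (1 + ‖φ 0‖) / (1 - ‖φ 0‖) :=
    div_nonneg (by linarith [norm_nonneg (φ 0)]) (by linarith)
  have hun := h2NormSq_nonneg u
  set C := 2 * (M ^ 2 * ((1 + ‖φ 0‖) / (1 - ‖φ 0‖)) + 1 / δ * h2NormSq u) with hC
  have hCn : 0 ≤ C := by positivity
  have hpoly : ∀ g : Polynomial ℂ, ∀ r, 0 < r → r < 1 → avg (fun z => u z * g.eval (φ z)) r ≤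
      C * ∑ i ∈ g.support, ‖g.coeff i‖ ^ 2 := by
    intro g r h0 h1
    have hh := mul_poly_mem hu hφ hm g
    have ht := (eps_tendsto hh).const_mul 2 |>.const_add (C * ∑ i ∈ g.support, ‖g.coeff i‖ ^ 2)
    simp only [mul_zero, add_zero] at ht
    refine ge_of_tendsto ht ?_
    have h3 : ∀ᶠ t : ℝ in nhdsWithin 1 (Iio 1), r < t ∧ t < 1 :=
        Filter.Eventually.and (nhdsWithin_le_nhds (lt_mem_nhds h1)) self_mem_nhdsWithin
    filter_upwards [h3] with t ht
    refine (avg_mono hh.1 h0.le ht.1.le ht.2).trans ?_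
    refine (wcomp_step hu hφH hm hδ hess g hh (h0.trans ht.1) ht.2).trans (le_of_eq ?_)
    rw [hC]
    ring
  refine ⟨C, hCn, fun g hg => ?_⟩
  have hhd : DifferentiableOn ℂ (fun z => u z * g (φ z)) unitDisk :=
    hu.1.mul (hg.1.comp hφ hm)
  refine memH2_of_avg hhd (ρ := 0) one_pos fun r _ h0 h1 => ?_
  let P : ℕ → Polynomial ℂ := fun K =>
    ∑ k ∈ Finset.range K, Polynomial.monomial k (taylorCoeff g k)
  have hc : ∀ K j, (P K).coeff j = if j < K then taylorCoeff g j else 0 := by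
    intro K j
    simp [P, Polynomial.finsetSum_coeff, Polynomial.coeff_monomial]
  have hP : ∀ K, ∑ i ∈ (P K).support, ‖(P K).coeff i‖ ^ 2 ≤ h2NormSq g := by
    intro K
    refine le_trans (Finset.sum_le_sum fun i _ => ?_) (hg.2.sum_le_tsum _ (fun _ _ => by positivity))
    rw [hc]
    split_ifs
    · exact le_rfl
    · simp
  have hd : ∀ K, DifferentiableOn ℂ (fun z => u z * (P K).eval (φ z)) unitDisk :=
    fun K => (mul_poly_mem hu hφ hm (P K)).1
  have hp := Real.pi_pos
  have key := fatou_bound (F := fun K θ => ‖u (circleMap 0 r θ) * (P K).eval (φ (circleMap 0 r θ))‖ ^ 2)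
    (f := fun θ => ‖u (circleMap 0 r θ) * g (φ (circleMap 0 r θ))‖ ^ 2)
    (B := 2 * Real.pi * (C * h2NormSq g)) (fun K => (circInt (hd K) h0.le h1).norm.pow 2)
    (fun _ _ => by positivity) ((circInt hhd h0.le h1).norm.pow 2) (fun _ => by positivity) ?_ ?_
    (by have := h2NormSq_nonneg g; positivity)
  · rw [int_avg (fun z => u z * g (φ z))] at key
    exact le_of_mul_le_mul_left key (by positivity)
  · refine Eventually.of_forall fun θ => ⟨_, ?_, le_rfl⟩
    refine (Tendsto.const_mul _ ?_).norm.pow 2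
    have hz : ‖φ (circleMap 0 r θ)‖ < 1 := mem_uD.1 (hm _ (by simp [mem_uD, abs_of_pos h0, h1]))
    refine (hasSum_tay hg.1 hz).tendsto_sum_nat.congr fun K => ?_
    simp only [P, Polynomial.eval_finsetSum, Polynomial.eval_monomial]
  · intro K
    rw [int_avg (fun z => u z * (P K).eval (φ z))]
    gcongr
    refine (hpoly (P K) r h0 h1).trans ?_
    gcongr
    exact hP K

lemma h2_add {f g : ℂ → ℂ} (hf : MemH2 f) (hg : MemH2 g) :
    MemH2 (fun z => f z + g z) ∧
      h2NormSq (fun z => f z + g z) ≤ 2 * h2NormSq f + 2 * h2NormSq g := by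
  have hd : DifferentiableOn ℂ (fun z => f z + g z) unitDisk := hf.1.add hg.1
  have hc : ∀ k, taylorCoeff (fun z => f z + g z) k = taylorCoeff f k + taylorCoeff g k := by
    refine tay_unique hd fun z hz => ?_
    refine ((hasSum_tay hf.1 hz).add (hasSum_tay hg.1 hz)).congr_fun ?_
    intro k
    ring
  have hle : ∀ k, ‖taylorCoeff (fun z => f z + g z) k‖ ^ 2 ≤
      2 * ‖taylorCoeff f k‖ ^ 2 + 2 * ‖taylorCoeff g k‖ ^ 2 := by
    intro k
    rw [hc]
    have h1 := norm_add_le (taylorCoeff f k) (taylorCoeff g k)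
    have h2 : ‖taylorCoeff f k + taylorCoeff g k‖ ^ 2 ≤
      (‖taylorCoeff f k‖ + ‖taylorCoeff g k‖) ^ 2 := by gcongr
    nlinarith [sq_nonneg (‖taylorCoeff f k‖ - ‖taylorCoeff g k‖)]
  have hs := (hf.2.mul_left 2).add (hg.2.mul_left 2)
  have hs2 := Summable.of_nonneg_of_le (fun k => by positivity) hle hs
  refine ⟨⟨hd, hs2⟩, ?_⟩
  refine (hs2.tsum_le_tsum hle hs).trans (le_of_eq ?_)
  rw [(hf.2.mul_left 2).tsum_add (hg.2.mul_left 2), tsum_mul_left, tsum_mul_left]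
  rfl

lemma h2_mul {f B : ℂ → ℂ} (hf : MemH2 f) (hB : DifferentiableOn ℂ B unitDisk) {K : ℝ}
    (hK : ∀ z ∈ unitDisk, ‖B z‖ ≤ K) :
    MemH2 (fun z => B z * f z) ∧ h2NormSq (fun z => B z * f z) ≤ K ^ 2 * h2NormSq f := by
  have := memH2_of_le (hB.mul hf.1) hf (ρ := 0) (A := K ^ 2) (B := 0) one_pos (by positivity)
    fun z _ hz => by
      have h1 := hK z (mem_uD.2 hz)
      have h2 : ‖B z‖ ^ 2 ≤ K ^ 2 := by gcongr
      simp only [Pi.mul_apply]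
      rw [norm_mul, mul_pow, add_zero]
      gcongr
  rwa [add_zero] at this

lemma poly_bdd (P : Polynomial ℂ) : ∃ K : ℝ, ∀ z ∈ unitDisk, ‖P.eval z‖ ≤ K := by
  obtain ⟨K, hK⟩ := (isCompact_closedBall (0:ℂ) 1).exists_bound_of_continuousOn
    (f := fun z => P.eval z) (by fun_prop)
  exact ⟨K, fun z hz => hK z (by simpa using (mem_uD.1 hz).le)⟩

lemma exists_factor {n : ℕ} {A : Polynomial ℂ} (hA : A.Monic) (hn : A.natDegree = n + 1) :
    ∃ x A', A = (Polynomial.X - Polynomial.C x) * A' ∧ A'.Monic ∧ A'.natDegree = n := by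
  obtain ⟨x, hx⟩ := IsAlgClosed.exists_root A (by
    rw [Polynomial.degree_eq_natDegree hA.ne_zero, hn]
    exact_mod_cast Nat.succ_ne_zero n)
  obtain ⟨A', hA'⟩ := Polynomial.dvd_iff_isRoot.2 hx
  have hm : A'.Monic := (Polynomial.monic_X_sub_C x).of_mul_monic_left (hA' ▸ hA)
  refine ⟨x, A', hA', hm, ?_⟩
  have := (Polynomial.monic_X_sub_C x).natDegree_mul hm
  rw [← hA', hn, Polynomial.natDegree_X_sub_C] at this
  omega

lemma uniq {g : ℂ → ℂ} (hg : MemH2 g) : ∀ (n : ℕ) (A q : Polynomial ℂ), A.Monic → A.natDegree = n →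
    (∀ x, A.IsRoot x → ‖x‖ = 1) → q.degree < (n : WithBot ℕ) →
    (∀ z ∈ unitDisk, A.eval z * g z = q.eval z) → q = 0 := by
  intro n
  induction n with
  | zero =>
    intro A q _ _ _ hq _
    rw [← Polynomial.degree_eq_bot]
    simpa using hq
  | succ n ih =>
    intro A q hA hn hr hq h
    obtain ⟨x, A', hAA, hm, hn'⟩ := exists_factor hA hn
    have hx : ‖x‖ = 1 := hr x (by rw [hAA]; simp [Polynomial.IsRoot])
    obtain ⟨K, hK⟩ := poly_bdd A'
    have hq0 : q.eval x = 0 := by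
      have h1 : Tendsto (fun r : ℝ => ‖q.eval (r * x)‖ ^ 2) (nhdsWithin 1 (Iio 1))
          (nhds (‖q.eval x‖ ^ 2)) := by
        have : Continuous (fun r : ℝ => ‖q.eval (r * x)‖ ^ 2) := by fun_prop
        have h2 := this.tendsto 1
        simp only [ofReal_one, one_mul] at h2
        exact h2.mono_left nhdsWithin_le_nhds
      have h2 : Tendsto (fun r : ℝ => K ^ 2 * h2NormSq g * (1 - r)) (nhdsWithin 1 (Iio 1))
          (nhds 0) := by
        have : Continuous (fun r : ℝ => K ^ 2 * h2NormSq g * (1 - r)) := by fun_prop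
        have h2 := this.tendsto 1
        simp only [sub_self, mul_zero] at h2
        exact h2.mono_left nhdsWithin_le_nhds
      have h3 : ‖q.eval x‖ ^ 2 ≤ 0 := by
        refine le_of_tendsto_of_tendsto h1 h2 ?_
        have h3 : ∀ᶠ r : ℝ in nhdsWithin 1 (Iio 1), 0 < r ∧ r < 1 :=
          Filter.Eventually.and (nhdsWithin_le_nhds (lt_mem_nhds (by norm_num)))
            self_mem_nhdsWithin
        filter_upwards [h3] with r hr
        have hnr : ‖(r:ℂ) * x‖ = r := by simp [hx, abs_of_pos hr.1]
        have hmem : (r:ℂ) * x ∈ unitDisk := mem_uD.2 (by rw [hnr]; exact hr.2)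
        rw [← h _ hmem, hAA]
        simp only [Polynomial.eval_mul, Polynomial.eval_sub, Polynomial.eval_X, Polynomial.eval_C]
        have e : ‖(r:ℂ) * x - x‖ = 1 - r := by
          rw [show (r:ℂ) * x - x = ((r - 1 : ℝ) : ℂ) * x by push_cast; ring, norm_mul, hx, mul_one,
            norm_real, Real.norm_eq_abs, abs_of_neg (by linarith)]
          ring
        rw [norm_mul, norm_mul, e]
        have k1 := growth hg (z := (r:ℂ) * x) (by rw [hnr]; exact hr.2)
        rw [hnr] at k1
        have k2 := hK _ hmem
        have h1r : 0 ≤ 1 - r := by linarith [hr.2]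
        have k3 : ‖A'.eval ((r:ℂ) * x)‖ ^ 2 ≤ K ^ 2 := by gcongr
        calc _ = ‖A'.eval ((r:ℂ) * x)‖ ^ 2 * (‖g (r * x)‖ ^ 2 * (1 - r)) * (1 - r) := by ring
          _ ≤ K ^ 2 * h2NormSq g * (1 - r) := by gcongr
      have h4 : ‖q.eval x‖ ^ 2 = 0 := le_antisymm h3 (by positivity)
      simpa using h4
    obtain ⟨q', hq'⟩ := Polynomial.dvd_iff_isRoot.2 hq0
    have hq0' : q' = 0 := by
      refine ih A' q' hm hn' ?_ ?_ ?_
      · intro y hy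
        apply hr
        rw [hAA]
        simp only [Polynomial.IsRoot] at hy ⊢
        simp [hy]
      · by_cases h0 : q' = 0
        · simp [h0]
        · rw [hq', Polynomial.degree_mul, Polynomial.degree_X_sub_C,
            Polynomial.degree_eq_natDegree h0] at hq
          rw [Polynomial.degree_eq_natDegree h0]
          have : 1 + q'.natDegree < n + 1 := by exact_mod_cast hq
          have : q'.natDegree < n := by omega
          exact_mod_cast this
      · intro z hz
        have := h z hz
        rw [hAA, hq'] at this
        simp only [Polynomial.eval_mul, Polynomial.eval_sub, Polynomial.eval_X,
          Polynomial.eval_C] at this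
        have hne : z - x ≠ 0 := by
          intro h0
          have := mem_uD.1 hz
          rw [sub_eq_zero.1 h0, hx] at this
          exact lt_irrefl _ this
        rw [mul_assoc] at this
        exact mul_left_cancel₀ hne this
    rw [hq', hq0', mul_zero]

lemma div_lemma : ∀ (n : ℕ) (Q : Polynomial ℂ), Q.Monic → Q.natDegree = n →
    (∀ x, Q.IsRoot x → ‖x‖ < 1) → ∃ C : ℝ, 0 ≤ C ∧ ∀ g, MemH2 g → ∃ (k : ℂ → ℂ) (s : Polynomial ℂ),
      MemH2 k ∧ s.degree < (n : WithBot ℕ) ∧ (∀ z ∈ unitDisk, g z = Q.eval z * k z + s.eval z) ∧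
      h2NormSq k ≤ C * h2NormSq g ∧ h2NormSq (fun z => s.eval z) ≤ C * h2NormSq g := by
  intro n
  induction n with
  | zero =>
    intro Q hQ hn _
    refine ⟨1, zero_le_one, fun g hg => ⟨g, 0, hg, ?_, ?_, ?_, ?_⟩⟩
    · simp
    · intro z _
      simp [hQ.natDegree_eq_zero.1 hn]
    · simp
    · rw [(h2_poly 0).2]
      simpa using h2NormSq_nonneg g
  | succ n ih =>
    intro Q hQ hn hr
    obtain ⟨x, Q', hQQ, hm, hn'⟩ := exists_factor hQ hn
    have hx : ‖x‖ < 1 := hr x (by rw [hQQ]; simp [Polynomial.IsRoot])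
    obtain ⟨C, hC0, hC⟩ := ih Q' hm hn' (by
      intro y hy
      apply hr
      rw [hQQ]
      simp only [Polynomial.IsRoot] at hy ⊢
      simp [hy])
    set d := (1 - ‖x‖) / 2 with hd
    have hd0 : 0 < d := by rw [hd]; linarith
    set E := C / (1 - ‖x‖) with hE
    have hE0 : 0 ≤ E := div_nonneg hC0 (by linarith)
    set S := h2NormSq (fun z => Q'.eval z) with hS
    have hS0 : 0 ≤ S := h2NormSq_nonneg _
    refine ⟨2 / d ^ 2 * C + 2 / d ^ 2 * E + (2 * E * S + 2 * C), by positivity, fun g hg => ?_⟩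
    obtain ⟨k, s, hk, hs, hdec, hkn, hsn⟩ := hC g hg
    have hgn := h2NormSq_nonneg g
    have hkx : ‖k x‖ ^ 2 ≤ E * h2NormSq g := by
      have := growth hk hx
      rw [hE, div_mul_eq_mul_div, le_div_iff₀ (by linarith)]
      linarith
    have hdk : DifferentiableOn ℂ (dslope k x) unitDisk :=
      (Complex.differentiableOn_dslope (isOpen_uD.mem_nhds (mem_uD.2 hx))).2 hk.1
    have hds : ∀ z, k z = (z - x) * dslope k x z + k x := by
      intro z
      have := sub_smul_dslope k x z
      rw [smul_eq_mul] at this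
      rw [this]
      ring
    have hb := memH2_of_le hdk hk (ρ := (1 + ‖x‖) / 2) (A := 2 / d ^ 2)
      (B := 2 / d ^ 2 * ‖k x‖ ^ 2) (by linarith) (by positivity) (by
      intro z hz1 hz2
      have h1 : d ≤ ‖z - x‖ := by
        have := norm_sub_norm_le z x
        rw [hd]
        linarith
      have h2 : ‖z - x‖ * ‖dslope k x z‖ ≤ ‖k z‖ + ‖k x‖ := by
        rw [← norm_mul, show (z - x) * dslope k x z = k z - k x by rw [hds z]; ring]
        exact norm_sub_le _ _
      have h3 : d * ‖dslope k x z‖ ≤ ‖k z‖ + ‖k x‖ := le_trans (by gcongr) h2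
      have h4 : (d * ‖dslope k x z‖) ^ 2 ≤ (‖k z‖ + ‖k x‖) ^ 2 := by gcongr
      have h5 : d ^ 2 * ‖dslope k x z‖ ^ 2 ≤ 2 * ‖k z‖ ^ 2 + 2 * ‖k x‖ ^ 2 := by
        nlinarith [sq_nonneg (‖k z‖ - ‖k x‖)]
      have h6 : ‖dslope k x z‖ ^ 2 ≤ (2 * ‖k z‖ ^ 2 + 2 * ‖k x‖ ^ 2) / d ^ 2 := by
        rw [le_div_iff₀ (by positivity)]
        linarith
      refine h6.trans (le_of_eq ?_)
      ring)
    have hsm := h2_mul (h2_poly Q').1 (B := fun _ => k x) (by fun_prop) (K := ‖k x‖)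
      (fun _ _ => le_rfl)
    have hsa := h2_add hsm.1 (h2_poly s).1
    refine ⟨dslope k x, Polynomial.C (k x) * Q' + s, hb.1, ?_, ?_, ?_, ?_⟩
    · refine lt_of_le_of_lt (Polynomial.degree_add_le _ _) (max_lt ?_ ?_)
      · rw [← Polynomial.smul_eq_C_mul]
        refine lt_of_le_of_lt (Polynomial.degree_smul_le _ _) ?_
        rw [Polynomial.degree_eq_natDegree hm.ne_zero, hn']
        exact_mod_cast Nat.lt_succ_self n
      · exact hs.trans (by exact_mod_cast Nat.lt_succ_self n)
    · intro z hz
      rw [hdec z hz, hds z, hQQ]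
      simp only [Polynomial.eval_mul, Polynomial.eval_sub, Polynomial.eval_X, Polynomial.eval_C,
        Polynomial.eval_add]
      ring
    · refine hb.2.trans ?_
      have e : 0 ≤ (2 * E * S + 2 * C) * h2NormSq g := by positivity
      calc _ ≤ 2 / d ^ 2 * (C * h2NormSq g) + 2 / d ^ 2 * (E * h2NormSq g) := by gcongr
        _ ≤ _ := by linarith
    · simp only [Polynomial.eval_add, Polynomial.eval_mul, Polynomial.eval_C]
      refine hsa.2.trans ?_
      have e : 0 ≤ (2 / d ^ 2 * C + 2 / d ^ 2 * E) * h2NormSq g := by positivity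
      calc _ ≤ 2 * (‖k x‖ ^ 2 * S) + 2 * (C * h2NormSq g) := by
            have := hsm.2
            gcongr
        _ ≤ 2 * (E * h2NormSq g * S) + 2 * (C * h2NormSq g) := by gcongr
        _ ≤ _ := by linarith

/-- product of linear factors over a finset, as a polynomial -/
def facPoly {n : ℕ} (s : Finset (Fin n)) (x : Fin n → ℂ) (m : Fin n → ℕ) : Polynomial ℂ :=
  ∏ j ∈ s, (Polynomial.X - Polynomial.C (x j)) ^ (m j)

lemma facPoly_monic {n : ℕ} (s : Finset (Fin n)) (x : Fin n → ℂ) (m : Fin n → ℕ) :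
    (facPoly s x m).Monic :=
  Polynomial.monic_prod_of_monic _ _ fun j _ => (Polynomial.monic_X_sub_C _).pow _

lemma facPoly_natDegree {n : ℕ} (s : Finset (Fin n)) (x : Fin n → ℂ) (m : Fin n → ℕ) :
    (facPoly s x m).natDegree = ∑ j ∈ s, m j := by
  rw [facPoly, Polynomial.natDegree_prod_of_monic _ _
    fun j _ => (Polynomial.monic_X_sub_C _).pow _]
  refine Finset.sum_congr rfl fun j _ => ?_
  rw [(Polynomial.monic_X_sub_C _).natDegree_pow, Polynomial.natDegree_X_sub_C, mul_one]

lemma facPoly_eval {n : ℕ} (s : Finset (Fin n)) (x : Fin n → ℂ) (m : Fin n → ℕ) (z : ℂ) :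
    (facPoly s x m).eval z = ∏ j ∈ s, (z - x j) ^ (m j) := by
  simp [facPoly, Polynomial.eval_prod]

lemma facPoly_root {n : ℕ} {s : Finset (Fin n)} {x : Fin n → ℂ} {m : Fin n → ℕ} {z : ℂ}
    (h : (facPoly s x m).eval z = 0) : ∃ j ∈ s, z = x j := by
  rw [facPoly_eval, Finset.prod_eq_zero_iff] at h
  obtain ⟨j, hj, h0⟩ := h
  exact ⟨j, hj, sub_eq_zero.1 (by by_contra hne; exact pow_ne_zero _ hne h0)⟩

lemma hbNormSq_eq {n : ℕ} {ξ : Fin n → ℂ} {m : Fin n → ℕ} (hξ : ∀ j, ‖ξ j‖ = 1)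
    {f g : ℂ → ℂ} {q : Polynomial ℂ} (h : HbDecompOf ξ m f g q) :
    hbNormSq ξ m f = h2NormSq g + h2NormSq (fun z => q.eval z) := by
  have hM : MemHb ξ m f := ⟨(g, q), h⟩
  have hc : HbDecompOf ξ m f (hbDecomp ξ m f).1 (hbDecomp ξ m f).2 := by
    rw [hbDecomp, dif_pos hM]
    exact hM.choose_spec
  set g' := (hbDecomp ξ m f).1
  set q' := (hbDecomp ξ m f).2
  have e : ∀ z, a1fun ξ m z = (facPoly Finset.univ ξ m).eval z := fun z => by
    rw [facPoly_eval]
    rfl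
  have hneg := h2_mul hc.1 (B := fun _ => -1) (by fun_prop) (K := 1) (by simp)
  have hsub := (h2_add h.1 hneg.1).1
  have h0 : q' - q = 0 := by
    refine uniq hsub _ (facPoly Finset.univ ξ m) (q' - q) (facPoly_monic _ _ _)
      (facPoly_natDegree _ _ _) ?_ ?_ ?_
    · intro x hx
      obtain ⟨j, _, rfl⟩ := facPoly_root hx
      exact hξ j
    · exact lt_of_le_of_lt (Polynomial.degree_sub_le _ _) (max_lt hc.2.1 h.2.1)
    · intro z hz
      have h1 := h.2.2 z hz
      have h2 := hc.2.2 z hz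
      rw [e] at h1 h2
      rw [Polynomial.eval_sub]
      linear_combination h2 - h1
  have hq : q' = q := sub_eq_zero.1 h0
  have hg : h2NormSq g' = h2NormSq g := by
    refine h2_congr hc.1.1 h.1.1 fun z hz => ?_
    have h1 := h.2.2 z hz
    have h2 := hc.2.2 z hz
    rw [h1, hq] at h2
    have h3 := add_right_cancel h2
    refine (mul_left_cancel₀ ?_ h3).symm
    rw [e]
    intro h4
    obtain ⟨j, _, hj⟩ := facPoly_root h4
    have := mem_uD.1 hz
    rw [hj, hξ j] at this
    exact lt_irrefl _ this
  change h2NormSq g' + h2NormSq (fun z => q'.eval z) = _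
  rw [hg, hq]

lemma phi_pow {n : ℕ} {ξ : Fin n → ℂ} {m : Fin n → ℕ} {φ : ℂ → ℂ} (hφb : MemHb ξ m φ)
    (hφ : DifferentiableOn ℂ φ unitDisk) (hm : ∀ z ∈ unitDisk, φ z ∈ unitDisk) (j : ℕ) :
    ∃ (G : ℂ → ℂ) (R : Polynomial ℂ), HbDecompOf ξ m (fun z => φ z ^ j) G R := by
  obtain ⟨⟨h, r⟩, hh, hr, hdec⟩ := hφb
  simp only at hh hr hdec
  set A := facPoly Finset.univ ξ m with hA
  have hAm : A.Monic := facPoly_monic _ _ _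
  have e : ∀ z, a1fun ξ m z = A.eval z := fun z => by
    rw [hA, facPoly_eval]
    rfl
  have hdeg : A.degree = ((∑ j, m j : ℕ) : WithBot ℕ) := by
    rw [Polynomial.degree_eq_natDegree hAm.ne_zero, hA, facPoly_natDegree]
  have hmod : ∀ P : Polynomial ℂ, (P %ₘ A).degree < ((∑ j, m j : ℕ) : WithBot ℕ) := fun P => by
    rw [← hdeg]
    exact Polynomial.degree_modByMonic_lt P hAm
  have hev : ∀ (P : Polynomial ℂ) z, P.eval z = A.eval z * (P /ₘ A).eval z + (P %ₘ A).eval z := by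
    intro P z
    conv_lhs => rw [← Polynomial.modByMonic_add_div P A]
    rw [Polynomial.eval_add, Polynomial.eval_mul]
    ring
  induction j with
  | zero =>
    refine ⟨fun z => (1 /ₘ A : Polynomial ℂ).eval z, 1 %ₘ A, (h2_poly _).1, hmod _, fun z _ => ?_⟩
    have := hev 1 z
    rw [e, ← this]
    simp
  | succ j ih =>
    obtain ⟨G, R, hG, hR, hd⟩ := ih
    have m1 := h2_mul hG hφ (K := 1) (fun z hz => (mem_uD.1 (hm z hz)).le)
    obtain ⟨K, hK⟩ := poly_bdd R
    have m2 := h2_mul hh (B := fun z => R.eval z) (by fun_prop) hK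
    have m3 := (h2_add (h2_add m1.1 m2.1).1 (h2_poly ((r * R) /ₘ A)).1).1
    refine ⟨_, (r * R) %ₘ A, m3, hmod _, fun z hz => ?_⟩
    have h1 := hdec z hz
    have h2 := hd z hz
    simp only at h2
    have h3 := hev (r * R) z
    rw [Polynomial.eval_mul] at h3
    rw [e] at h1 h2 ⊢
    show φ z ^ (j + 1) = _
    rw [pow_succ, h2]
    linear_combination (R.eval z) * h1 + h3

lemma sum_bound (G : ℕ → ℂ → ℂ) (hG : ∀ j, MemH2 (G j)) (L : ℕ) :
    ∃ C : ℝ, 0 ≤ C ∧ ∀ (c : ℕ → ℂ) (B : ℝ), (∀ j, ‖c j‖ ^ 2 ≤ B) →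
      MemH2 (fun z => ∑ j ∈ Finset.range L, c j * G j z) ∧
      h2NormSq (fun z => ∑ j ∈ Finset.range L, c j * G j z) ≤ C * B := by
  induction L with
  | zero =>
    refine ⟨0, le_rfl, fun c B hB => ?_⟩
    have h := h2_poly 0
    simp only [Polynomial.eval_zero, Polynomial.support_zero, Finset.sum_empty] at h
    simpa using ⟨h.1, h.2.le⟩
  | succ L ih =>
    obtain ⟨C, hC0, hC⟩ := ih
    have hn := h2NormSq_nonneg (G L)
    refine ⟨2 * C + 2 * h2NormSq (G L), by positivity, fun c B hB => ?_⟩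
    obtain ⟨h1, h2⟩ := hC c B hB
    have h3 := h2_mul (hG L) (B := fun _ => c L) (by fun_prop) (K := ‖c L‖) (fun _ _ => le_rfl)
    have h4 := h2_add h1 h3.1
    simp only [Finset.sum_range_succ]
    refine ⟨h4.1, h4.2.trans ?_⟩
    have h5 : ‖c L‖ ^ 2 * h2NormSq (G L) ≤ B * h2NormSq (G L) := by
      have := hB L
      gcongr
    linarith [h3.2]

/-- Corollary 4.4. If `u ∈ H²` and `|u|` is essentially bounded on
`A_δ = {ζ ∈ T : |φ(ζ)| ≥ 1 − δ}` for some `δ > 0`, then `C_φ` is bounded on `H(b)`. -/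
theorem comp_bounded_of_esssup
    (b a : ℂ → ℂ) (n : ℕ) (ξ : Fin n → ℂ) (m : Fin n → ℕ)
    (hset : RationalSetting b a n ξ m)
    (φ : ℂ → ℂ) (hφb : MemHb ξ m φ) (hφball : MemBallHinf φ)
    (hφmap : ∀ z ∈ unitDisk, φ z ∈ unitDisk)
    (Λ : Fin n → ℂ) (hΛ : ∀ j, NTLimit φ (ξ j) (Λ j))
    (p : ℕ) (hp : p ≤ n)
    (hΛcirc : ∀ j : Fin n, (j : ℕ) < p → ∃ i, Λ j = ξ i)
    (hΛdisk : ∀ j : Fin n, p ≤ (j : ℕ) → Λ j ∈ unitDisk)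
    (hu : MemH2 (ufun p ξ m Λ φ))
    (hess : ∃ δ > (0:ℝ), ∃ M : ℝ,
      ∀ᵐ (θ : ℝ) ∂(volume.restrict (Set.Ioc (0:ℝ) (2 * Real.pi))),
        1 - δ ≤ ‖bdryVal φ (Complex.exp (θ * Complex.I))‖ →
          ‖bdryVal (ufun p ξ m Λ φ) (Complex.exp (θ * Complex.I))‖ ≤ M) :
    CompBddHb ξ m φ := by


  have hφ := hφball.1
  have hξ : ∀ j, ‖ξ j‖ = 1 := fun j => by
    have := hset.zeros_mem j
    simpa [unitCircle] using this
  obtain ⟨δ, hδ, M, hM⟩ := hess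
  obtain ⟨C₁, hC₁, hW⟩ := wcomp_bdd hu hφ hφmap hδ hM
  set F := Finset.univ.filter fun j : Fin n => p ≤ (j : ℕ) with hF
  set A := facPoly Finset.univ ξ m with hA
  set Q := facPoly F Λ m with hQ
  have e : ∀ z, a1fun ξ m z = A.eval z := fun z => by
    rw [hA, facPoly_eval]
    rfl
  obtain ⟨C₂, hC₂, hD⟩ := div_lemma _ Q (facPoly_monic _ _ _) rfl (by
    intro x hx
    obtain ⟨j, hj, rfl⟩ := facPoly_root hx
    exact mem_uD.1 (hΛdisk j (Finset.mem_filter.1 hj).2))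
  obtain ⟨K, hK⟩ := poly_bdd A
  choose G R hGR using phi_pow hφb hφ hφmap
  set L := A.natDegree + Q.natDegree + 1 with hL
  obtain ⟨C₃, hC₃, hG⟩ := sum_bound G (fun j => (hGR j).1) L
  obtain ⟨C₄, hC₄, hR⟩ := sum_bound (fun j z => (R j).eval z) (fun j => (h2_poly (R j)).1) L
  have hAN : A.natDegree = ∑ j, m j := facPoly_natDegree _ _ _
  set C := 2 * (C₁ * C₂) + (2 * C₃ + C₄) * (2 * (K ^ 2 * C₂) + 2) with hC
  have main : ∀ f, MemHb ξ m f → MemHb ξ m (fun z => f (φ z)) ∧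
      hbNormSq ξ m (fun z => f (φ z)) ≤ C * hbNormSq ξ m f := by
    rintro f ⟨⟨g, q⟩, hdec⟩
    have hdec' := hdec
    obtain ⟨hg, hq, hfe⟩ := hdec'
    simp only at hg hq hfe
    obtain ⟨k, s, hk, hs, hgk, hkn, hsn⟩ := hD g hg
    set P := A * s + q with hP
    have hPdeg : P.natDegree < L := by
      have h1 : (A * s).natDegree ≤ A.natDegree + s.natDegree := Polynomial.natDegree_mul_le
      have h2 : s.natDegree ≤ Q.natDegree :=
        Polynomial.natDegree_le_of_degree_le hs.le
      have h3 : q.natDegree ≤ A.natDegree := by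
        rw [hAN]
        exact Polynomial.natDegree_le_of_degree_le hq.le
      have h4 := Polynomial.natDegree_add_le (A * s) q
      have h5 : max (A * s).natDegree q.natDegree ≤ A.natDegree + Q.natDegree :=
        max_le (by omega) (by omega)
      exact lt_of_le_of_lt (h4.trans h5) (by omega)
    have p1 := h2_mul (h2_poly s).1 (B := fun z => A.eval z) (by fun_prop) hK
    have p2 := h2_add p1.1 (h2_poly q).1
    have pe : (fun z => P.eval z) = fun z => A.eval z * s.eval z + q.eval z := by
      funext z
      simp [hP]
    set B := 2 * (K ^ 2 * (C₂ * h2NormSq g)) + 2 * h2NormSq (fun z => q.eval z) with hB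
    have hcoef : ∀ j, ‖P.coeff j‖ ^ 2 ≤ B := by
      intro j
      have h1 := coeff_le (h2_poly P).1 j
      rw [tay_poly, pe] at h1
      refine h1.trans (p2.2.trans ?_)
      have h2 := p1.2
      have h3 : K ^ 2 * h2NormSq (fun z => s.eval z) ≤ K ^ 2 * (C₂ * h2NormSq g) := by gcongr
      linarith
    obtain ⟨g1, g2⟩ := hG P.coeff B hcoef
    obtain ⟨r1, r2⟩ := hR P.coeff B hcoef
    obtain ⟨w1, w2⟩ := hW k hk
    have t := h2_add w1 g1
    set RR : Polynomial ℂ := ∑ j ∈ Finset.range L, Polynomial.C (P.coeff j) * R j with hRR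
    have hRe : (fun z => RR.eval z) = fun z => ∑ j ∈ Finset.range L, P.coeff j * (R j).eval z := by
      funext z
      simp [hRR, Polynomial.eval_finsetSum]
    have hfin : HbDecompOf ξ m (fun z => f (φ z))
        (fun z => ufun p ξ m Λ φ z * k (φ z) + ∑ j ∈ Finset.range L, P.coeff j * G j z) RR := by
      refine ⟨t.1, ?_, ?_⟩
      · rw [← Polynomial.mem_degreeLT]
        refine Submodule.sum_mem _ fun j _ => ?_
        rw [← Polynomial.smul_eq_C_mul]
        exact Submodule.smul_mem _ _ (Polynomial.mem_degreeLT.2 (hGR j).2.1)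
      · intro z hz
        have hφz := hφmap z hz
        have hAz : a1fun ξ m z ≠ 0 := by
          rw [e]
          intro h4
          obtain ⟨j, _, hj⟩ := facPoly_root h4
          have := mem_uD.1 hz
          rw [hj, hξ j] at this
          exact lt_irrefl _ this
        have hu' : a1fun ξ m z * ufun p ξ m Λ φ z = A.eval (φ z) * Q.eval (φ z) := by
          rw [ufun, ← e, hQ, facPoly_eval]
          field_simp
          congr 1
        have hPφ : P.eval (φ z) = ∑ j ∈ Finset.range L, P.coeff j * φ z ^ j :=
          Polynomial.eval_eq_sum_range' hPdeg _
        have hsum : ∑ j ∈ Finset.range L, P.coeff j * φ z ^ j =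
            a1fun ξ m z * ∑ j ∈ Finset.range L, P.coeff j * G j z +
              ∑ j ∈ Finset.range L, P.coeff j * (R j).eval z := by
          rw [Finset.mul_sum, ← Finset.sum_add_distrib]
          refine Finset.sum_congr rfl fun j _ => ?_
          have := (hGR j).2.2 z hz
          simp only at this
          rw [this]
          ring
        have hRz := congrFun hRe z
        show f (φ z) = a1fun ξ m z * (ufun p ξ m Λ φ z * k (φ z) +
          ∑ j ∈ Finset.range L, P.coeff j * G j z) + RR.eval z
        have hPe : P.eval (φ z) = A.eval (φ z) * s.eval (φ z) + q.eval (φ z) := congrFun pe (φ z)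
        have hRz' : RR.eval z = ∑ j ∈ Finset.range L, P.coeff j * (R j).eval z := hRz
        rw [hRz', hfe _ hφz, hgk _ hφz, e (φ z)]
        linear_combination hPφ - hPe + hsum - k (φ z) * hu'
    refine ⟨⟨(_, _), hfin⟩, ?_⟩
    rw [hbNormSq_eq hξ hfin, hbNormSq_eq hξ hdec, hRe]
    have n1 := h2NormSq_nonneg g
    have n2 := h2NormSq_nonneg (fun z => q.eval z)
    have s1 : C₁ * h2NormSq k ≤ C₁ * (C₂ * h2NormSq g) := by gcongr
    have s2 : h2NormSq (fun z => ufun p ξ m Λ φ z * k (φ z) +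
        ∑ j ∈ Finset.range L, P.coeff j * G j z) +
        h2NormSq (fun z => ∑ j ∈ Finset.range L, P.coeff j * (R j).eval z) ≤
        2 * (C₁ * (C₂ * h2NormSq g)) + (2 * C₃ + C₄) * B := by
      linarith [t.2]
    refine s2.trans ?_
    have s3 : B ≤ (2 * (K ^ 2 * C₂) + 2) * (h2NormSq g + h2NormSq (fun z => q.eval z)) := by
      have a1 : 0 ≤ K ^ 2 * C₂ * h2NormSq (fun z => q.eval z) := by positivity
      rw [hB]
      linarith
    have s4 : (2 * C₃ + C₄) * B ≤ (2 * C₃ + C₄) *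
      ((2 * (K ^ 2 * C₂) + 2) * (h2NormSq g + h2NormSq (fun z => q.eval z))) := by gcongr
    have s5 : 0 ≤ C₁ * C₂ * h2NormSq (fun z => q.eval z) := by positivity
    rw [hC]
    simp only
    linarith
  exact ⟨fun f hf => (main f hf).1, C, fun f hf => (main f hf).2⟩

end
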